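/- Let d ≥ 3, γ > d−2 with γ ∉ ℕ, and let f be a function on ℝ^d∖B₁ satisfying |f(x)| ≤ |x|^{−(γ+2)} for all |x| ≥ 1. Then there exists a function u such that Δu = f in ℝ^d∖B₁ and, for all x with r = |x| ≥ 1, |u(x)|/r + |∇u(x)| ≤ C r^{−(γ+1)}, where the constant C depends only on d and γ. -/

import Mathlib

open MeasureTheory Filter Metric Real
open scoped ENNReal NNReal Topology

noncomputable section

/-- `d`-dimensional Euclidean space. -/
abbrev Ed (d : ℕ) : Type := EuclideanSpace ℝ (Fin d)

/-- The Laplacian `Δu = Σ_i ∂²_{ii} u` of a scalar function on `ℝ^d`. -/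
def lapScalar (d : ℕ) (u : Ed d → ℝ) (x : Ed d) : ℝ :=
  ∑ i : Fin d, iteratedFDeriv ℝ 2 u x (fun _ => EuclideanSpace.single i (1 : ℝ))

/-- The directional derivative `∂_v h`. -/
def dirDeriv {d : ℕ} (v : Ed d) (h : Ed d → ℝ) (x : Ed d) : ℝ := fderiv ℝ h x v

/-- The `k`-th standard basis vector of `ℝ^d`. -/
abbrev stdVec {d : ℕ} (k : Fin d) : Ed d := EuclideanSpace.single k (1 : ℝ)

section Derivatives

variable {d : ℕ}

lemma contDiffAt_dirDeriv {h : Ed d → ℝ} {x : Ed d} (hh : ContDiffAt ℝ (⊤ : ℕ∞) h x) (v : Ed d) :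
    ContDiffAt ℝ (⊤ : ℕ∞) (dirDeriv v h) x :=
  (hh.fderiv_right (m := (⊤ : ℕ∞)) (by simp)).clm_apply contDiffAt_const

lemma dirDeriv_congr {g h : Ed d → ℝ} {x : Ed d} (hgh : g =ᶠ[𝓝 x] h) (v : Ed d) :
    dirDeriv v g =ᶠ[𝓝 x] dirDeriv v h := by
  filter_upwards [hgh.fderiv (𝕜 := ℝ)] with y hy
  simp only [dirDeriv, hy]

lemma dirDeriv_comm {h : Ed d → ℝ} {x : Ed d} (hh : ContDiffAt ℝ (⊤ : ℕ∞) h x) (v w : Ed d) :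
    dirDeriv v (dirDeriv w h) x = dirDeriv w (dirDeriv v h) x := by
  have hd : DifferentiableAt ℝ (fderiv ℝ h) x :=
    (hh.fderiv_right (m := 1) (by norm_cast)).differentiableAt (by simp)
  have key : ∀ a b : Ed d, dirDeriv a (dirDeriv b h) x = fderiv ℝ (fderiv ℝ h) x a b := by
    intro a b
    have := (hd.hasFDerivAt.clm_apply (hasFDerivAt_const b x)).fderiv
    simp only [dirDeriv]
    change fderiv ℝ (fun y => fderiv ℝ h y b) x a = _
    rw [this]
    simp
  rw [key, key]
  exact hh.isSymmSndFDerivAt (by simpa using WithTop.coe_le_coe.2 (le_top : (2 : ℕ∞) ≤ ⊤)) v w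

lemma lapScalar_eq_sum_of_differentiableAt {h : Ed d → ℝ} {x : Ed d}
    (hd : DifferentiableAt ℝ (fderiv ℝ h) x) :
    lapScalar d h x = ∑ i, dirDeriv (stdVec i) (dirDeriv (stdVec i) h) x := by
  unfold lapScalar
  refine Finset.sum_congr rfl fun i _ => ?_
  rw [iteratedFDeriv_two_apply]
  have := (hd.hasFDerivAt.clm_apply (hasFDerivAt_const (stdVec i) x)).fderiv
  simp only [dirDeriv]
  change _ = fderiv ℝ (fun y => fderiv ℝ h y (stdVec i)) x (stdVec i)
  rw [this]
  simp

lemma lapScalar_eq_sum {h : Ed d → ℝ} {x : Ed d} (hh : ContDiffAt ℝ (⊤ : ℕ∞) h x) :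
    lapScalar d h x = ∑ i, dirDeriv (stdVec i) (dirDeriv (stdVec i) h) x :=
  lapScalar_eq_sum_of_differentiableAt
    ((hh.fderiv_right (m := 1) (by norm_cast)).differentiableAt (by simp))

lemma lapScalar_congr {g h : Ed d → ℝ} {x : Ed d} (hgh : g =ᶠ[𝓝 x] h) :
    lapScalar d g x = lapScalar d h x := by
  unfold lapScalar
  rw [(hgh.iteratedFDeriv ℝ 2).eq_of_nhds]

lemma dirDeriv_sum {ι : Type*} (s : Finset ι) (F : ι → Ed d → ℝ) (v x : Ed d)
    (hF : ∀ i ∈ s, DifferentiableAt ℝ (F i) x) :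
    dirDeriv v (fun y => ∑ i ∈ s, F i y) x = ∑ i ∈ s, dirDeriv v (F i) x := by
  simp only [dirDeriv]
  rw [fderiv_fun_sum hF]
  simp

lemma dirDeriv_const_mul (c : ℝ) {F : Ed d → ℝ} (v : Ed d) {x : Ed d}
    (hF : DifferentiableAt ℝ F x) :
    dirDeriv v (fun y => c * F y) x = c * dirDeriv v F x := by
  simp only [dirDeriv]
  rw [fderiv_const_mul hF]
  simp

lemma eq_sum_smul_stdVec (v : Ed d) : v = ∑ k, v k • stdVec k := by
  ext i
  simp [Finset.sum_apply, Pi.single_apply]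

lemma dirDeriv_eq_sum (h : Ed d → ℝ) (v x : Ed d) :
    dirDeriv v h x = ∑ k, v k * dirDeriv (stdVec k) h x := by
  simp only [dirDeriv]
  conv_lhs => rw [eq_sum_smul_stdVec v]
  rw [map_sum]
  simp

/-- Partial derivatives of harmonic functions are harmonic. -/
lemma lapScalar_dirDeriv_eq_zero {h : Ed d → ℝ} {x : Ed d} (v : Ed d)
    (hh : ∀ᶠ y in 𝓝 x, ContDiffAt ℝ (⊤ : ℕ∞) h y) (hlap : ∀ᶠ y in 𝓝 x, lapScalar d h y = 0) :
    lapScalar d (dirDeriv v h) x = 0 := by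
  have hx := hh.self_of_nhds
  rw [lapScalar_eq_sum (contDiffAt_dirDeriv hx v)]
  have h1 : ∀ i : Fin d, dirDeriv (stdVec i) (dirDeriv (stdVec i) (dirDeriv v h)) x =
      dirDeriv v (dirDeriv (stdVec i) (dirDeriv (stdVec i) h)) x := by
    intro i
    have e : dirDeriv (stdVec i) (dirDeriv v h) =ᶠ[𝓝 x] dirDeriv v (dirDeriv (stdVec i) h) := by
      filter_upwards [hh] with y hy using dirDeriv_comm hy _ _
    rw [(dirDeriv_congr e (stdVec i)).eq_of_nhds, dirDeriv_comm (contDiffAt_dirDeriv hx _)]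
  simp only [h1]
  rw [← dirDeriv_sum _ _ _ _ fun i _ =>
    (contDiffAt_dirDeriv (contDiffAt_dirDeriv hx (stdVec i)) (stdVec i)).differentiableAt (by simp)]
  have e : (fun y => ∑ i : Fin d, dirDeriv (stdVec i) (dirDeriv (stdVec i) h) y)
      =ᶠ[𝓝 x] fun _ => 0 := by
    filter_upwards [hh, hlap] with y hy hy'
    rw [← lapScalar_eq_sum hy, hy']
  rw [(dirDeriv_congr e v).eq_of_nhds]
  simp [dirDeriv]

lemma norm_le_sum_norm_stdVec {F : Type*} [NormedAddCommGroup F] [NormedSpace ℝ F]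
    (L : Ed d →L[ℝ] F) : ‖L‖ ≤ ∑ k, ‖L (stdVec k)‖ := by
  refine L.opNorm_le_bound (by positivity) fun v => ?_
  conv_lhs => rw [eq_sum_smul_stdVec v]
  rw [map_sum, Finset.sum_mul]
  refine (norm_sum_le _ _).trans (Finset.sum_le_sum fun k _ => ?_)
  rw [map_smul, norm_smul, mul_comm]
  gcongr
  exact PiLp.norm_apply_le v k

lemma fderiv_fderiv_apply {h : Ed d → ℝ} {x : Ed d} (hh : ContDiffAt ℝ (⊤ : ℕ∞) h x) (v : Ed d) :
    fderiv ℝ (fderiv ℝ h) x v = fderiv ℝ (dirDeriv v h) x := by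
  have hd : DifferentiableAt ℝ (fderiv ℝ h) x :=
    (hh.fderiv_right (m := 1) (by norm_cast)).differentiableAt (by simp)
  ext w
  have := (hd.hasFDerivAt.clm_apply (hasFDerivAt_const v x)).fderiv
  rw [hh.isSymmSndFDerivAt (by simpa using WithTop.coe_le_coe.2 (le_top : (2 : ℕ∞) ≤ ⊤)) v w]
  change _ = fderiv ℝ (fun y => fderiv ℝ h y v) x w
  rw [this]
  simp

lemma lapScalar_eq_laplacian (u : Ed d → ℝ) : lapScalar d u = Laplacian.laplacian u := by
  ext x
  rw [InnerProductSpace.laplacian_eq_iteratedFDeriv_orthonormalBasis u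
    (EuclideanSpace.basisFun (Fin d) ℝ)]
  refine Finset.sum_congr rfl fun i _ => ?_
  congr 1
  ext j
  fin_cases j <;> simp

end Derivatives

/-- Harmonic functions on `ℝ^d∖{0}` that are positively homogeneous of degree `-a`. -/
structure HomogHarmonic {d : ℕ} (a : ℕ) (h : Ed d → ℝ) : Prop where
  smooth : ∀ x ≠ 0, ContDiffAt ℝ (⊤ : ℕ∞) h x
  homog : ∀ t : ℝ, 0 < t → ∀ x ≠ 0, h (t • x) = (t ^ a)⁻¹ * h x
  harmonic : ∀ x ≠ 0, lapScalar d h x = 0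

namespace HomogHarmonic

variable {d a : ℕ} {h : Ed d → ℝ}

lemma eventually_smooth (hh : HomogHarmonic a h) {x : Ed d} (hx : x ≠ 0) :
    ∀ᶠ y in 𝓝 x, ContDiffAt ℝ (⊤ : ℕ∞) h y := by
  filter_upwards [isOpen_ne.mem_nhds hx] with y hy using hh.smooth y hy

lemma differentiableAt (hh : HomogHarmonic a h) {x : Ed d} (hx : x ≠ 0) :
    DifferentiableAt ℝ h x :=
  (hh.smooth x hx).differentiableAt (by simp)

lemma dirDeriv (hh : HomogHarmonic a h) (v : Ed d) : HomogHarmonic (a + 1) (dirDeriv v h) where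
  smooth x hx := contDiffAt_dirDeriv (hh.smooth x hx) v
  harmonic x hx := by
    refine lapScalar_dirDeriv_eq_zero v (hh.eventually_smooth hx) ?_
    filter_upwards [isOpen_ne.mem_nhds hx] with y hy using hh.harmonic y hy
  homog t ht x hx := by
    have htx : t • x ≠ 0 := smul_ne_zero ht.ne' hx
    have e : (fun y => h (t • y)) =ᶠ[𝓝 x] fun y => (t ^ a)⁻¹ * h y := by
      filter_upwards [isOpen_ne.mem_nhds hx] with y hy using hh.homog t ht y hy
    have h1 := (dirDeriv_congr e v).eq_of_nhds
    rw [dirDeriv_const_mul _ _ (hh.differentiableAt hx)] at h1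
    have h2 : _root_.dirDeriv v (fun y => h (t • y)) x = t * _root_.dirDeriv v h (t • x) := by
      have hd : HasFDerivAt (fun y : Ed d => t • y) (t • ContinuousLinearMap.id ℝ (Ed d)) x :=
        (hasFDerivAt_id x).const_smul t
      have := ((hh.differentiableAt htx).hasFDerivAt.comp x hd).fderiv
      simp only [_root_.dirDeriv]
      change fderiv ℝ (h ∘ fun y => t • y) x v = _
      rw [this]
      simp
    rw [h2] at h1
    have ht' := ht.ne'
    field_simp
    rw [pow_succ]
    field_simp at h1
    linear_combination h1

lemma exists_bound (hh : HomogHarmonic a h) :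
    ∃ C : ℝ, 0 ≤ C ∧ ∀ x ≠ 0, |h x| ≤ C * (‖x‖ ^ a)⁻¹ := by
  have hc : ContinuousOn h (sphere 0 1) := fun x hx =>
    (hh.smooth x (ne_zero_of_mem_unit_sphere ⟨x, hx⟩)).continuousAt.continuousWithinAt
  obtain ⟨C, hC⟩ := (isCompact_sphere (0 : Ed d) 1).exists_bound_of_continuousOn hc
  refine ⟨max C 0, le_max_right _ _, fun x hx => ?_⟩
  have hx' : 0 < ‖x‖ := norm_pos_iff.2 hx
  have hy : ‖x‖⁻¹ • x ∈ sphere (0 : Ed d) 1 := by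
    simp [norm_smul, hx'.ne']
  have h1 := hh.homog ‖x‖ hx' (‖x‖⁻¹ • x) (ne_zero_of_mem_unit_sphere ⟨_, hy⟩)
  rw [smul_inv_smul₀ hx'.ne'] at h1
  rw [h1, abs_mul, abs_of_nonneg (by positivity : (0 : ℝ) ≤ (‖x‖ ^ a)⁻¹), mul_comm]
  gcongr
  exact (hC _ hy).trans (le_max_left _ _)

lemma exists_fderiv_bound (hh : HomogHarmonic a h) :
    ∃ C : ℝ, 0 ≤ C ∧ ∀ x ≠ 0, ‖fderiv ℝ h x‖ ≤ C * (‖x‖ ^ (a + 1))⁻¹ := by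
  choose C hC0 hC using fun k : Fin d => (hh.dirDeriv (stdVec k)).exists_bound
  refine ⟨∑ k, C k, Finset.sum_nonneg fun k _ => hC0 k, fun x hx => ?_⟩
  refine (norm_le_sum_norm_stdVec _).trans ?_
  rw [Finset.sum_mul]
  exact Finset.sum_le_sum fun k _ => hC k x hx

lemma iterate_dirDeriv (hh : HomogHarmonic a h) (v : Ed d) (j : ℕ) :
    HomogHarmonic (a + j) ((_root_.dirDeriv v)^[j] h) := by
  induction j with
  | zero => exact hh
  | succ j ih =>
    rw [Function.iterate_succ_apply']
    exact ih.dirDeriv v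

lemma iterate_dirDeriv_comm (hh : HomogHarmonic a h) (v w : Ed d) (j : ℕ) {x : Ed d} (hx : x ≠ 0) :
    _root_.dirDeriv w ((_root_.dirDeriv v)^[j] h) x =
      (_root_.dirDeriv v)^[j] (_root_.dirDeriv w h) x := by
  induction j generalizing x with
  | zero => rfl
  | succ j ih =>
    rw [Function.iterate_succ_apply', Function.iterate_succ_apply',
      dirDeriv_comm ((hh.iterate_dirDeriv v j).smooth x hx)]
    refine (dirDeriv_congr ?_ v).eq_of_nhds
    filter_upwards [isOpen_ne.mem_nhds hx] with y hy using ih hy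

/-- The `j`-th directional derivative is a polynomial in the direction with coefficients that are
homogeneous functions of the base point. -/
lemma exists_expansion (hh : HomogHarmonic a h) (j : ℕ) :
    ∃ (ι : Type) (_ : Fintype ι) (p q : ι → Ed d → ℝ),
      (∀ i, Continuous (p i)) ∧ (∀ i y, |p i y| ≤ ‖y‖ ^ j) ∧ (∀ i, HomogHarmonic (a + j) (q i)) ∧
      ∀ x ≠ 0, ∀ y, (_root_.dirDeriv y)^[j] h x = ∑ i, p i y * q i x := by
  induction j with
  | zero =>
    exact ⟨Unit, inferInstance, fun _ _ => 1, fun _ => h, fun _ => continuous_const, by simp,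
      fun _ => hh, by simp⟩
  | succ j ih =>
    obtain ⟨ι, _, p, q, hp, hpb, hq, hpq⟩ := ih
    refine ⟨ι × Fin d, inferInstance, fun i y => p i.1 y * y i.2,
      fun i => _root_.dirDeriv (stdVec i.2) (q i.1), fun i => ?_, fun i y => ?_,
      fun i => (hq i.1).dirDeriv _, fun x hx y => ?_⟩
    · exact (hp i.1).mul (by fun_prop)
    · rw [abs_mul, pow_succ]
      gcongr
      · exact hpb i.1 y
      · exact PiLp.norm_apply_le y i.2
    · rw [Function.iterate_succ_apply']
      have e : (_root_.dirDeriv y)^[j] h =ᶠ[𝓝 x] fun z => ∑ i, p i y * q i z := by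
        filter_upwards [isOpen_ne.mem_nhds hx] with z hz using hpq z hz y
      rw [(dirDeriv_congr e y).eq_of_nhds, dirDeriv_sum _ _ _ _ fun i _ =>
        ((hq i).differentiableAt hx).const_mul _, Fintype.sum_prod_type]
      refine Finset.sum_congr rfl fun i _ => ?_
      rw [dirDeriv_const_mul _ _ ((hq i).differentiableAt hx), dirDeriv_eq_sum, Finset.mul_sum]
      simp only [mul_assoc]

lemma exists_iterate_bound (hh : HomogHarmonic a h) (j : ℕ) :
    ∃ C : ℝ, 0 ≤ C ∧ ∀ x ≠ 0, ∀ y,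
      |(_root_.dirDeriv y)^[j] h x| ≤ C * ‖y‖ ^ j * (‖x‖ ^ (a + j))⁻¹ := by
  obtain ⟨ι, _, p, q, -, hpb, hq, hpq⟩ := hh.exists_expansion j
  choose C hC0 hC using fun i => (hq i).exists_bound
  refine ⟨∑ i, C i, Finset.sum_nonneg fun i _ => hC0 i, fun x hx y => ?_⟩
  rw [hpq x hx y, Finset.sum_mul, Finset.sum_mul]
  refine (Finset.abs_sum_le_sum_abs _ _).trans (Finset.sum_le_sum fun i _ => ?_)
  rw [abs_mul, mul_comm (C i), mul_assoc]
  exact mul_le_mul (hpb i y) (hC i x hx) (abs_nonneg _) (by positivity)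

lemma hasDerivAt_iterate_dirDeriv (hh : HomogHarmonic a h) (j : ℕ) {x y : Ed d} {t : ℝ}
    (hx : x + t • y ≠ 0) :
    HasDerivAt (fun s : ℝ => (_root_.dirDeriv y)^[j] h (x + s • y))
      ((_root_.dirDeriv y)^[j + 1] h (x + t • y)) t := by
  have h1 := ((hh.iterate_dirDeriv y j).differentiableAt hx).hasFDerivAt
  have h2 : HasDerivAt (fun s : ℝ => x + s • y) y t := by
    simpa using ((hasDerivAt_id t).smul_const y).const_add x
  rw [Function.iterate_succ_apply']
  exact h1.comp_hasDerivAt t h2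

/-- Taylor's theorem for homogeneous functions. -/
lemma exists_taylor_bound (hh : HomogHarmonic a h) (N : ℕ) :
    ∃ C : ℝ, 0 ≤ C ∧ ∀ x ≠ 0, ∀ y, ‖y‖ ≤ ‖x‖ / 2 →
      |h (x + y) - ∑ j ∈ Finset.range (N + 1), ((j.factorial : ℝ))⁻¹ * (_root_.dirDeriv y)^[j] h x|
        ≤ C * ‖y‖ ^ (N + 1) * (‖x‖ ^ (a + N + 1))⁻¹ := by
  obtain ⟨C, hC0, hC⟩ := hh.exists_iterate_bound (N + 1)
  refine ⟨C * 2 ^ (a + N + 1), by positivity, fun x hx y hy => ?_⟩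
  have hx' : 0 < ‖x‖ := norm_pos_iff.2 hx
  have hlow : ∀ t ∈ Set.Icc (0 : ℝ) 1, ‖x‖ / 2 ≤ ‖x + t • y‖ := by
    intro t ht
    have h1 : ‖t • y‖ ≤ ‖y‖ := by
      rw [norm_smul, Real.norm_of_nonneg ht.1]
      exact mul_le_of_le_one_left (norm_nonneg _) ht.2
    have h2 := norm_sub_le (x + t • y) (t • y)
    rw [add_sub_cancel_right] at h2
    linarith
  have hne : ∀ t ∈ Set.Icc (0 : ℝ) 1, x + t • y ≠ 0 := fun t ht =>
    norm_pos_iff.1 (by linarith [hlow t ht])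
  have hd : ∀ t ∈ Set.Icc (0 : ℝ) 1, ∀ n : ℕ, HasDerivAt
      (fun s : ℝ => ∑ j ∈ Finset.range (n + 1), ((j.factorial : ℝ))⁻¹ * ((1 - s) ^ j *
        (_root_.dirDeriv y)^[j] h (x + s • y)))
      (((n.factorial : ℝ))⁻¹ * ((1 - t) ^ n * (_root_.dirDeriv y)^[n + 1] h (x + t • y))) t := by
    intro t ht n
    induction n with
    | zero =>
      simpa using hh.hasDerivAt_iterate_dirDeriv 0 (hne t ht)
    | succ n ih =>
      have h1 : HasDerivAt (fun s : ℝ => (1 - s) ^ (n + 1)) (-((n + 1 : ℝ) * (1 - t) ^ n)) t := by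
        have := ((hasDerivAt_id t).const_sub 1).fun_pow (n + 1)
        simpa using this
      have h2 := ih.fun_add ((h1.fun_mul (hh.hasDerivAt_iterate_dirDeriv (n + 1) (hne t ht))).const_mul
        ((((n + 1).factorial : ℕ) : ℝ))⁻¹)
      simp only [Finset.sum_range_succ _ (n + 1)]
      refine h2.congr_deriv ?_
      have h3 : (n.factorial : ℝ) ≠ 0 := by positivity
      have h4 : (n : ℝ) + 1 ≠ 0 := by positivity
      rw [Nat.factorial_succ]
      push_cast
      field_simp
      ring
  have key := norm_image_sub_le_of_norm_deriv_le_segment_01'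
    (C := C * 2 ^ (a + N + 1) * ‖y‖ ^ (N + 1) * (‖x‖ ^ (a + N + 1))⁻¹)
    (fun t ht => (hd t ht N).hasDerivWithinAt) (fun t ht => ?_)
  · rw [Real.norm_eq_abs] at key
    convert key using 3
    · rw [Finset.sum_range_succ']
      simp
    · simp
  · have ht' : t ∈ Set.Icc (0 : ℝ) 1 := ⟨ht.1, ht.2.le⟩
    have h0 : 0 ≤ 1 - t := by linarith [ht.2]
    rw [norm_mul, norm_mul, Real.norm_of_nonneg (by positivity), Real.norm_of_nonneg (by positivity),
      Real.norm_eq_abs]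
    have h1 : ((N.factorial : ℝ))⁻¹ ≤ 1 :=
      inv_le_one_of_one_le₀ (by exact_mod_cast N.factorial_pos)
    have h2 : (1 - t) ^ N ≤ 1 := pow_le_one₀ h0 (by linarith [ht.1])
    calc _ ≤ 1 * (1 * |(_root_.dirDeriv y)^[N + 1] h (x + t • y)|) := by gcongr
      _ ≤ C * ‖y‖ ^ (N + 1) * (‖x + t • y‖ ^ (a + N + 1))⁻¹ := by
        rw [one_mul, one_mul]
        exact hC _ (hne t ht') y
      _ ≤ C * ‖y‖ ^ (N + 1) * ((‖x‖ / 2) ^ (a + N + 1))⁻¹ := by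
        gcongr
        exact hlow t ht'
      _ = _ := by
        rw [div_pow, inv_div, div_eq_mul_inv]
        ring

lemma abs_sub_le_of_fderiv_bound {F : Ed d → ℝ} {x₀ : Ed d} {B : ℝ}
    (hd : ∀ x ∈ ball x₀ (‖x₀‖ / 8), DifferentiableAt ℝ F x)
    (hB : ∀ x ∈ ball x₀ (‖x₀‖ / 8), ‖fderiv ℝ F x‖ ≤ B) {x x' : Ed d}
    (hx : x ∈ ball x₀ (‖x₀‖ / 8)) (hx' : x' ∈ ball x₀ (‖x₀‖ / 8)) :
    |F x - F x'| ≤ B * ‖x - x'‖ :=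
  (convex_ball x₀ (‖x₀‖ / 8)).norm_image_sub_le_of_norm_fderiv_le hd hB hx' hx

lemma half_le_norm_of_mem_ball {x₀ x : Ed d} (hx : x ∈ ball x₀ (‖x₀‖ / 8)) :
    ‖x₀‖ / 2 ≤ ‖x‖ := by
  rw [mem_ball, dist_eq_norm] at hx
  have := norm_sub_norm_le x₀ x
  rw [norm_sub_rev] at this
  have := norm_nonneg x₀
  linarith

/-- Lipschitz bound for the Taylor polynomial terms. -/
lemma exists_iterate_lipschitz (hh : HomogHarmonic a h) (j : ℕ) :
    ∃ C : ℝ, 0 ≤ C ∧ ∀ x₀ ≠ 0, ∀ x ∈ ball x₀ (‖x₀‖ / 8), ∀ x' ∈ ball x₀ (‖x₀‖ / 8), ∀ y,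
      |(_root_.dirDeriv y)^[j] h x - (_root_.dirDeriv y)^[j] h x'| ≤
        C * ‖y‖ ^ j * (‖x₀‖ ^ (a + j + 1))⁻¹ * ‖x - x'‖ := by
  choose C hC0 hC using fun k : Fin d => (hh.dirDeriv (stdVec k)).exists_iterate_bound j
  refine ⟨(∑ k, C k) * 2 ^ (a + j + 1), mul_nonneg (Finset.sum_nonneg fun k _ => hC0 k)
    (by positivity), fun x₀ hx₀ x hx x' hx' y => ?_⟩
  have hx₀' : 0 < ‖x₀‖ := norm_pos_iff.2 hx₀
  have hne : ∀ z ∈ ball x₀ (‖x₀‖ / 8), z ≠ 0 := fun z hz =>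
    norm_pos_iff.1 (by linarith [half_le_norm_of_mem_ball hz])
  refine abs_sub_le_of_fderiv_bound
    (fun z hz => (hh.iterate_dirDeriv y j).differentiableAt (hne z hz)) (fun z hz => ?_) hx hx'
  refine (norm_le_sum_norm_stdVec _).trans ?_
  rw [Finset.sum_mul, Finset.sum_mul, Finset.sum_mul]
  refine Finset.sum_le_sum fun k _ => ?_
  have h1 := hh.iterate_dirDeriv_comm y (stdVec k) j (hne z hz)
  simp only [_root_.dirDeriv] at h1
  have h2 := hC k z (hne z hz) y
  calc _ ≤ C k * ‖y‖ ^ j * (‖z‖ ^ (a + 1 + j))⁻¹ := by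
        refine le_trans (le_of_eq ?_) h2
        exact congrArg abs h1
    _ ≤ C k * ‖y‖ ^ j * ((‖x₀‖ / 2) ^ (a + 1 + j))⁻¹ := by
        have := hC0 k
        gcongr
        exact half_le_norm_of_mem_ball hz
    _ = _ := by
        rw [div_pow, inv_div, div_eq_mul_inv, add_right_comm a 1 j]
        ring

/-- Lipschitz bound for the Taylor remainder. -/
lemma exists_taylor_lipschitz (hh : HomogHarmonic a h) (N : ℕ) :
    ∃ C : ℝ, 0 ≤ C ∧ ∀ x₀ ≠ 0, ∀ x ∈ ball x₀ (‖x₀‖ / 8), ∀ x' ∈ ball x₀ (‖x₀‖ / 8), ∀ y,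
      ‖y‖ ≤ ‖x₀‖ / 4 →
      |(h (x + y) - ∑ j ∈ Finset.range (N + 1), ((j.factorial : ℝ))⁻¹ * (_root_.dirDeriv y)^[j] h x)
        - (h (x' + y) -
          ∑ j ∈ Finset.range (N + 1), ((j.factorial : ℝ))⁻¹ * (_root_.dirDeriv y)^[j] h x')| ≤
        C * ‖y‖ ^ (N + 1) * (‖x₀‖ ^ (a + N + 2))⁻¹ * ‖x - x'‖ := by
  choose C hC0 hC using fun k : Fin d => (hh.dirDeriv (stdVec k)).exists_taylor_bound N
  refine ⟨(∑ k, C k) * 2 ^ (a + N + 2), mul_nonneg (Finset.sum_nonneg fun k _ => hC0 k)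
    (by positivity), fun x₀ hx₀ x hx x' hx' y hy => ?_⟩
  have hx₀' : 0 < ‖x₀‖ := norm_pos_iff.2 hx₀
  have hne : ∀ z ∈ ball x₀ (‖x₀‖ / 8), z ≠ 0 := fun z hz =>
    norm_pos_iff.1 (by linarith [half_le_norm_of_mem_ball hz])
  have hne' : ∀ z ∈ ball x₀ (‖x₀‖ / 8), z + y ≠ 0 := by
    intro z hz h0
    have h1 := half_le_norm_of_mem_ball hz
    rw [eq_neg_of_add_eq_zero_left h0, norm_neg] at h1
    linarith
  have hd1 : ∀ z ∈ ball x₀ (‖x₀‖ / 8), HasFDerivAt (fun z => h (z + y)) (fderiv ℝ h (z + y)) z :=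
    fun z hz => (hasFDerivAt_comp_add_right y).2 (hh.differentiableAt (hne' z hz)).hasFDerivAt
  have hd2 : ∀ z ∈ ball x₀ (‖x₀‖ / 8), HasFDerivAt
      (fun z => ∑ j ∈ Finset.range (N + 1), ((j.factorial : ℝ))⁻¹ * (_root_.dirDeriv y)^[j] h z)
      (∑ j ∈ Finset.range (N + 1), ((j.factorial : ℝ))⁻¹ • fderiv ℝ ((_root_.dirDeriv y)^[j] h) z)
      z := fun z hz => HasFDerivAt.fun_sum fun j _ =>
    ((hh.iterate_dirDeriv y j).differentiableAt (hne z hz)).hasFDerivAt.const_mul _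
  refine abs_sub_le_of_fderiv_bound
    (F := fun z => h (z + y) - ∑ j ∈ Finset.range (N + 1), ((j.factorial : ℝ))⁻¹ *
      (_root_.dirDeriv y)^[j] h z)
    (fun z hz => ((hd1 z hz).sub (hd2 z hz)).differentiableAt) (fun z hz => ?_) hx hx'
  have h3 := ((hd1 z hz).fun_sub (hd2 z hz)).fderiv
  rw [h3]
  refine (norm_le_sum_norm_stdVec _).trans ?_
  rw [Finset.sum_mul, Finset.sum_mul, Finset.sum_mul]
  refine Finset.sum_le_sum fun k _ => ?_
  have h2 := hC k z (hne z hz) y (by linarith [half_le_norm_of_mem_ball hz])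
  calc _ ≤ C k * ‖y‖ ^ (N + 1) * (‖z‖ ^ (a + 1 + N + 1))⁻¹ := by
        refine le_trans (le_of_eq ?_) h2
        simp only [_root_.sub_apply, _root_.sum_apply,
          _root_.smul_apply, smul_eq_mul]
        congr 2
        refine Finset.sum_congr rfl fun j _ => ?_
        congr 1
        exact hh.iterate_dirDeriv_comm y (stdVec k) j (hne z hz)
    _ ≤ C k * ‖y‖ ^ (N + 1) * ((‖x₀‖ / 2) ^ (a + 1 + N + 1))⁻¹ := by
        have := hC0 k
        gcongr
        exact half_le_norm_of_mem_ball hz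
    _ = _ := by
        rw [div_pow, inv_div, div_eq_mul_inv, show a + 1 + N + 1 = a + N + 2 by ring]
        ring

end HomogHarmonic

section Fundamental

variable {d : ℕ}

/-- The power `(‖x‖² + e)^p`. -/
def regPow (d : ℕ) (e p : ℝ) (x : Ed d) : ℝ := (‖x‖ ^ 2 + e) ^ p

lemma contDiffAt_regPow {e : ℝ} (p : ℝ) {x : Ed d} (hx : ‖x‖ ^ 2 + e ≠ 0) :
    ContDiffAt ℝ (⊤ : ℕ∞) (regPow d e p) x :=
  (((contDiff_norm_sq ℝ).contDiffAt).add contDiffAt_const).rpow_const_of_ne hx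

lemma dirDeriv_regPow {e : ℝ} (p : ℝ) {x : Ed d} (hx : ‖x‖ ^ 2 + e ≠ 0) (i : Fin d) :
    dirDeriv (stdVec i) (regPow d e p) x = 2 * p * (x i * regPow d e (p - 1) x) := by
  have h1 : HasFDerivAt (fun y : Ed d => ‖y‖ ^ 2 + e) (2 • innerSL ℝ x) x :=
    (hasStrictFDerivAt_norm_sq x).hasFDerivAt.add_const e
  have h2 := (h1.rpow_const (p := p) (Or.inl hx)).fderiv
  simp only [dirDeriv]
  change fderiv ℝ (fun y : Ed d => (‖y‖ ^ 2 + e) ^ p) x (stdVec i) = _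
  rw [h2]
  simp [regPow, EuclideanSpace.inner_single_right]
  ring

lemma eventually_norm_sq_add_ne {e : ℝ} {x : Ed d} (hx : ‖x‖ ^ 2 + e ≠ 0) :
    ∀ᶠ y : Ed d in 𝓝 x, ‖y‖ ^ 2 + e ≠ 0 := by
  have : Continuous fun y : Ed d => ‖y‖ ^ 2 + e := by fun_prop
  exact this.continuousAt.eventually_ne hx

lemma dirDeriv_dirDeriv_regPow {e : ℝ} (p : ℝ) {x : Ed d} (hx : ‖x‖ ^ 2 + e ≠ 0) (i : Fin d) :
    dirDeriv (stdVec i) (dirDeriv (stdVec i) (regPow d e p)) x =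
      2 * p * (regPow d e (p - 1) x + 2 * (p - 1) * ((x i) ^ 2 * regPow d e (p - 2) x)) := by
  have e1 : dirDeriv (stdVec i) (regPow d e p) =ᶠ[𝓝 x]
      fun y => 2 * p * (y i * regPow d e (p - 1) y) := by
    filter_upwards [eventually_norm_sq_add_ne hx] with y hy using dirDeriv_regPow p hy i
  have hd : DifferentiableAt ℝ (regPow d e (p - 1)) x :=
    (contDiffAt_regPow (p - 1) hx).differentiableAt (by simp)
  have hc : HasFDerivAt (fun y : Ed d => y i) (EuclideanSpace.proj i : Ed d →L[ℝ] ℝ) x :=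
    (EuclideanSpace.proj i : Ed d →L[ℝ] ℝ).hasFDerivAt
  rw [(dirDeriv_congr e1 _).eq_of_nhds, dirDeriv_const_mul _ _ (hc.differentiableAt.fun_mul hd)]
  congr 1
  have h1 := dirDeriv_regPow (p - 1) hx i
  simp only [dirDeriv] at h1 ⊢
  rw [(hc.fun_mul hd.hasFDerivAt).fderiv]
  simp only [_root_.add_apply, _root_.smul_apply, smul_eq_mul, h1]
  rw [show p - 1 - 1 = p - 2 by ring]
  simp
  ring

lemma sum_dirDeriv_regPow {e : ℝ} {p : ℝ} (hp : 2 * p = 2 - d) {x : Ed d}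
    (hx : 0 < ‖x‖ ^ 2 + e) :
    ∑ i, dirDeriv (stdVec i) (dirDeriv (stdVec i) (regPow d e p)) x =
      -((d - 2 : ℝ) * d) * (e * regPow d e (p - 2) x) := by
  simp only [dirDeriv_dirDeriv_regPow p hx.ne']
  rw [← Finset.mul_sum, Finset.sum_add_distrib, ← Finset.mul_sum, ← Finset.sum_mul]
  have h1 : regPow d e (p - 1) x = (‖x‖ ^ 2 + e) * regPow d e (p - 2) x := by
    simp only [regPow]
    have h0 := Real.rpow_add hx 1 (p - 2)
    rw [Real.rpow_one] at h0
    rw [← h0]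
    congr 1
    ring
  have h2 : ∑ i, (x i) ^ 2 = ‖x‖ ^ 2 := by
    rw [EuclideanSpace.norm_sq_eq]; simp
  rw [h1, h2]
  simp only [Finset.sum_const, Finset.card_univ, Fintype.card_fin, nsmul_eq_mul]
  have h3 : p = (2 - d) / 2 := by linarith
  subst h3
  ring

/-- The kernel `‖x‖^{-m}`. -/
def invPow (d m : ℕ) (x : Ed d) : ℝ := (‖x‖ ^ m)⁻¹

lemma invPow_eq_regPow (m : ℕ) : invPow d m = regPow d 0 (-(m : ℝ) / 2) := by
  ext x
  simp only [invPow, regPow, add_zero]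
  rw [← Real.rpow_natCast_mul (norm_nonneg x), ← Real.rpow_natCast, ← Real.rpow_neg (norm_nonneg x)]
  congr 1
  push_cast
  ring

/-- `‖x‖^{2-d}` is harmonic and homogeneous away from the origin. -/
lemma homogHarmonic_invPow {m : ℕ} (hd : d = m + 2) :
    HomogHarmonic m (invPow d m) where
  smooth x hx := by
    rw [invPow_eq_regPow]
    exact contDiffAt_regPow _ (by simpa using hx)
  homog t ht x hx := by
    simp only [invPow, norm_smul, Real.norm_of_nonneg ht.le, mul_pow, mul_inv]
  harmonic x hx := by
    have hx' : 0 < ‖x‖ := norm_pos_iff.2 hx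
    rw [invPow_eq_regPow, lapScalar_eq_sum (contDiffAt_regPow _ (by simpa using hx)),
      sum_dirDeriv_regPow (by subst hd; push_cast; ring) (by positivity)]
    simp

lemma continuous_regPow {e : ℝ} (he : 0 < e) (p : ℝ) : Continuous (regPow d e p) :=
  (by fun_prop : Continuous fun x : Ed d => ‖x‖ ^ 2 + e).rpow_const
    fun x => Or.inl (by positivity)

lemma measurable_invPow (m : ℕ) : Measurable (invPow d m) := by
  unfold invPow; fun_prop

lemma locallyIntegrable_invPow {m : ℕ} (hd : m < d) :
    LocallyIntegrable (invPow d m) (volume : Measure (Ed d)) := by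
  refine locallyIntegrable_of_norm_le_rpow (C := 1) (α := m) (by simp; omega) (by simpa using hd)
    (Eventually.of_forall fun x => ?_) (measurable_invPow m).aestronglyMeasurable
  rw [one_mul, Real.rpow_neg (norm_nonneg x), Real.rpow_natCast, invPow,
    Real.norm_of_nonneg (by positivity)]

lemma contDiff_dirDeriv {φ : Ed d → ℝ} (hφ : ContDiff ℝ (⊤ : ℕ∞) φ) (v : Ed d) :
    ContDiff ℝ (⊤ : ℕ∞) (dirDeriv v φ) :=
  contDiff_iff_contDiffAt.2 fun _ => contDiffAt_dirDeriv hφ.contDiffAt v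

lemma hasCompactSupport_dirDeriv {φ : Ed d → ℝ} (hφ : HasCompactSupport φ) (v : Ed d) :
    HasCompactSupport (dirDeriv v φ) :=
  hφ.fderiv_apply ℝ v

lemma integral_mul_dirDeriv {g φ : Ed d → ℝ} (hg : ContDiff ℝ (⊤ : ℕ∞) g)
    (hφ : ContDiff ℝ (⊤ : ℕ∞) φ) (hc : HasCompactSupport φ) (v : Ed d) :
    ∫ x, g x * dirDeriv v φ x = -∫ x, dirDeriv v g x * φ x := by
  have hi : ∀ {a b : Ed d → ℝ}, Continuous a → Continuous b → HasCompactSupport b →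
      Integrable (fun x => a x * b x) := fun ha hb hb' =>
    (ha.mul hb).integrable_of_hasCompactSupport hb'.mul_left
  exact integral_mul_fderiv_eq_neg_fderiv_mul_of_integrable
    (hi (contDiff_dirDeriv hg v).continuous hφ.continuous hc)
    (hi hg.continuous (contDiff_dirDeriv hφ v).continuous (hasCompactSupport_dirDeriv hc v))
    (hi hg.continuous hφ.continuous hc)
    (fun _ _ => hg.contDiffAt.differentiableAt (by simp))
    (fun _ _ => hφ.contDiffAt.differentiableAt (by simp))

/-- The sum of the pure second derivatives, as iterated directional derivatives. -/
def sumDeriv (φ : Ed d → ℝ) (x : Ed d) : ℝ := ∑ i, dirDeriv (stdVec i) (dirDeriv (stdVec i) φ) x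

lemma continuous_sumDeriv {φ : Ed d → ℝ} (hφ : ContDiff ℝ (⊤ : ℕ∞) φ) : Continuous (sumDeriv φ) :=
  continuous_finsetSum _ fun _ _ => (contDiff_dirDeriv (contDiff_dirDeriv hφ _) _).continuous

lemma hasCompactSupport_sumDeriv {φ : Ed d → ℝ} (hφ : HasCompactSupport φ) :
    HasCompactSupport (sumDeriv φ) := by
  refine hφ.mono' (Function.support_subset_iff'.2 fun x hx => Finset.sum_eq_zero fun _ _ => ?_)
  by_contra h
  refine hx ?_
  have h1 := subset_tsupport _ (Function.mem_support.2 h)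
  exact (tsupport_fderiv_apply_subset ℝ (stdVec _)).trans
    (tsupport_fderiv_apply_subset ℝ (stdVec _)) h1

lemma integral_mul_sumDeriv {g φ : Ed d → ℝ} (hg : ContDiff ℝ (⊤ : ℕ∞) g)
    (hφ : ContDiff ℝ (⊤ : ℕ∞) φ) (hc : HasCompactSupport φ) :
    ∫ x, g x * sumDeriv φ x = ∫ x, sumDeriv g x * φ x := by
  have hi : ∀ {a b : Ed d → ℝ}, Continuous a → Continuous b → HasCompactSupport b →
      Integrable (fun x => a x * b x) := fun ha hb hb' =>
    (ha.mul hb).integrable_of_hasCompactSupport hb'.mul_left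
  simp only [sumDeriv, Finset.mul_sum, Finset.sum_mul]
  rw [integral_finsetSum, integral_finsetSum]
  · refine Finset.sum_congr rfl fun i _ => ?_
    rw [integral_mul_dirDeriv hg (contDiff_dirDeriv hφ _) (hasCompactSupport_dirDeriv hc _),
      integral_mul_dirDeriv (contDiff_dirDeriv hg _) hφ hc, neg_neg]
  · exact fun i _ => hi (contDiff_dirDeriv (contDiff_dirDeriv hg _) _).continuous hφ.continuous hc
  · exact fun i _ => hi hg.continuous (contDiff_dirDeriv (contDiff_dirDeriv hφ _) _).continuous
      (hasCompactSupport_dirDeriv (hasCompactSupport_dirDeriv hc _) _)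

/-- The normalising constant of the fundamental solution. -/
def fundConst (d : ℕ) : ℝ := (d - 2 : ℝ) * d * ∫ x : Ed d, regPow d 1 (-(d + 2 : ℝ) / 2) x

lemma integrable_regPow : Integrable (regPow d 1 (-(d + 2 : ℝ) / 2)) := by
  have := integrable_rpow_neg_one_add_norm_sq (E := Ed d) (μ := volume) (r := d + 2)
    (by simp)
  convert this using 2 with x
  rw [regPow, add_comm]

lemma fundConst_pos (hd : 2 < d) : 0 < fundConst d := by
  have h2 : (2 : ℝ) < d := by exact_mod_cast hd
  refine mul_pos (mul_pos (by linarith) (by linarith)) ?_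
  have hpos : ∀ x : Ed d, 0 < regPow d 1 (-(d + 2 : ℝ) / 2) x := fun x =>
    Real.rpow_pos_of_pos (by positivity) _
  rw [integral_pos_iff_support_of_nonneg (fun x => (hpos x).le) integrable_regPow]
  have : Function.support (regPow d 1 (-(d + 2 : ℝ) / 2)) = Set.univ :=
    Set.eq_univ_of_forall fun x => (hpos x).ne'
  rw [this]
  exact isOpen_univ.measure_pos volume Set.univ_nonempty

lemma integral_regPow_mul_sumDeriv {ε : ℝ} (hε : 0 < ε) {φ : Ed d → ℝ}
    (hφ : ContDiff ℝ (⊤ : ℕ∞) φ) (hc : HasCompactSupport φ) :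
    ∫ x, regPow d (ε ^ 2) ((2 - d : ℝ) / 2) x * sumDeriv φ x =
      -((d - 2 : ℝ) * d) * ∫ x, regPow d 1 (-(d + 2 : ℝ) / 2) x * φ (ε • x) := by
  have hs : ContDiff ℝ (⊤ : ℕ∞) (regPow d (ε ^ 2) ((2 - d : ℝ) / 2)) :=
    contDiff_iff_contDiffAt.2 fun x => contDiffAt_regPow _ (by positivity)
  rw [integral_mul_sumDeriv hs hφ hc]
  have h1 : ∀ x : Ed d, sumDeriv (regPow d (ε ^ 2) ((2 - d : ℝ) / 2)) x =
      -((d - 2 : ℝ) * d) * (ε ^ 2 * regPow d (ε ^ 2) (-(d + 2 : ℝ) / 2) x) := by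
    intro x
    rw [sumDeriv, sum_dirDeriv_regPow (by ring) (by positivity)]
    congr 4
    ring
  simp only [h1, mul_assoc]
  rw [integral_const_mul]
  have h2 := Measure.integral_comp_smul (volume : Measure (Ed d))
    (fun x => ε ^ 2 * (regPow d (ε ^ 2) (-(d + 2 : ℝ) / 2) x * φ x)) ε
  rw [abs_of_nonneg (by positivity), eq_inv_smul_iff₀ (by positivity)] at h2
  rw [smul_eq_mul] at h2
  rw [← h2]
  have h3 : ∀ x : Ed d, regPow d (ε ^ 2) (-(d + 2 : ℝ) / 2) (ε • x) =
      (ε ^ (d + 2))⁻¹ * regPow d 1 (-(d + 2 : ℝ) / 2) x := by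
    intro x
    simp only [regPow, norm_smul, Real.norm_of_nonneg hε.le]
    rw [show (ε * ‖x‖) ^ 2 + ε ^ 2 = ε ^ 2 * (‖x‖ ^ 2 + 1) by ring,
      Real.mul_rpow (by positivity) (by positivity), ← Real.rpow_natCast_mul hε.le,
      ← Real.rpow_natCast ε (d + 2), ← Real.rpow_neg hε.le]
    congr 2
    push_cast
    ring
  simp only [h3]
  rw [← integral_const_mul]
  congr 3
  ext x
  simp only [finrank_euclideanSpace, Fintype.card_fin]
  field_simp
  ring

/-- `-‖x‖^{2-d}` is, up to a constant, a fundamental solution of the Laplacian. -/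
lemma integral_invPow_mul_sumDeriv {m : ℕ} (hd : d = m + 2) {φ : Ed d → ℝ}
    (hφ : ContDiff ℝ (⊤ : ℕ∞) φ) (hc : HasCompactSupport φ) :
    ∫ x, invPow d m x * sumDeriv φ x = -fundConst d * φ 0 := by
  have hexp : (2 - d : ℝ) / 2 = -(m : ℝ) / 2 := by subst hd; push_cast; ring
  have hnz : ∀ᵐ x : Ed d, x ≠ 0 := by
    have : Nontrivial (Ed d) := by
      have : Nonempty (Fin d) := ⟨⟨0, by omega⟩⟩
      infer_instance
    exact Measure.ae_ne volume 0
  have hε : ∀ᶠ ε : ℝ in 𝓝[>] 0, 0 < ε := eventually_mem_nhdsWithin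
  have hid : Tendsto (fun ε : ℝ => ε) (𝓝[>] 0) (𝓝 0) := nhdsWithin_le_nhds
  have hint : Integrable (fun x => invPow d m x * sumDeriv φ x) :=
    (locallyIntegrable_invPow (by omega)).integrable_smul_right_of_hasCompactSupport
      (continuous_sumDeriv hφ) (hasCompactSupport_sumDeriv hc)
  have lim1 : Tendsto (fun ε : ℝ => ∫ x, regPow d (ε ^ 2) ((2 - d : ℝ) / 2) x * sumDeriv φ x)
      (𝓝[>] 0) (𝓝 (∫ x, invPow d m x * sumDeriv φ x)) := by
    refine tendsto_integral_filter_of_dominated_convergence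
      (fun x => ‖invPow d m x * sumDeriv φ x‖) ?_ ?_ hint.norm ?_
    · filter_upwards [hε] with ε hε
      exact ((continuous_regPow (by positivity) _).mul
        (continuous_sumDeriv hφ)).aestronglyMeasurable
    · filter_upwards [hε] with ε hε
      filter_upwards [hnz] with x hx
      have hx' : 0 < ‖x‖ := norm_pos_iff.2 hx
      rw [norm_mul, norm_mul]
      gcongr
      rw [invPow_eq_regPow, hexp, regPow, regPow,
        Real.norm_of_nonneg (by positivity), Real.norm_of_nonneg (by positivity)]
      have hm0 : (0 : ℝ) ≤ m := by positivity
      exact Real.rpow_le_rpow_of_nonpos (by positivity) (by nlinarith [sq_nonneg ε])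
        (by linarith)
    · filter_upwards [hnz] with x hx
      have hx' : 0 < ‖x‖ := norm_pos_iff.2 hx
      refine Tendsto.mul_const _ ?_
      rw [invPow_eq_regPow, hexp]
      simp only [regPow]
      refine Tendsto.rpow_const ?_ (Or.inl (by positivity))
      simpa using (hid.pow 2).const_add (‖x‖ ^ 2)
  obtain ⟨B, hB⟩ := hφ.continuous.bounded_above_of_compact_support hc
  have lim2 : Tendsto (fun ε : ℝ => ∫ x, regPow d 1 (-(d + 2 : ℝ) / 2) x * φ (ε • x))
      (𝓝[>] 0) (𝓝 (∫ x, regPow d 1 (-(d + 2 : ℝ) / 2) x * φ 0)) := by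
    refine tendsto_integral_filter_of_dominated_convergence
      (fun x => ‖regPow d 1 (-(d + 2 : ℝ) / 2) x‖ * B) ?_ ?_ (integrable_regPow.norm.mul_const B) ?_
    · refine Eventually.of_forall fun ε => ?_
      exact ((continuous_regPow one_pos _).mul
        (hφ.continuous.comp (continuous_const_smul ε))).aestronglyMeasurable
    · refine Eventually.of_forall fun ε => Eventually.of_forall fun x => ?_
      rw [norm_mul]
      gcongr
      exact hB _
    · refine Eventually.of_forall fun x => Tendsto.const_mul _ ?_
      refine (hφ.continuous.tendsto 0).comp ?_
      simpa using hid.smul_const x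
  have lim3 := lim2.const_mul (-((d - 2 : ℝ) * d))
  refine tendsto_nhds_unique (lim1.congr' ?_) (lim3.trans_eq ?_)
  · filter_upwards [hε] with ε hε using integral_regPow_mul_sumDeriv hε hφ hc
  · rw [integral_mul_const, fundConst]
    ring_nf

end Fundamental

section Newtonian

open scoped Convolution

variable {d : ℕ}

lemma dirDeriv_convolution {g φ : Ed d → ℝ} (hg : LocallyIntegrable g)
    (hφ : ContDiff ℝ (⊤ : ℕ∞) φ) (hc : HasCompactSupport φ) (v : Ed d) :
    dirDeriv v (g ⋆[ContinuousLinearMap.mul ℝ ℝ] φ) =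
      g ⋆[ContinuousLinearMap.mul ℝ ℝ] dirDeriv v φ := by
  ext x
  have h1 : ContDiff ℝ 1 φ := hφ.of_le (by norm_cast)
  simp only [dirDeriv]
  rw [(hc.hasFDerivAt_convolution_right (ContinuousLinearMap.mul ℝ ℝ) hg h1 x).fderiv,
    convolution_precompR_apply _ hg (hc.fderiv ℝ) (h1.continuous_fderiv (by simp))]
  rfl

lemma dirDeriv_comp_const_sub {φ : Ed d → ℝ} (hφ : ContDiff ℝ (⊤ : ℕ∞) φ) (x v : Ed d) :
    dirDeriv v (fun y => φ (x - y)) = fun y => -dirDeriv v φ (x - y) := by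
  ext y
  have h1 := (hφ.differentiable (by simp) (x - y)).hasFDerivAt.comp y
    ((hasFDerivAt_id y).const_sub x)
  simp only [dirDeriv]
  change fderiv ℝ (φ ∘ fun y => x - y) y v = _
  rw [HasFDerivAt.fderiv h1]
  simp

lemma dirDeriv_neg (v : Ed d) (h : Ed d → ℝ) :
    dirDeriv v (fun y => -h y) = fun y => -dirDeriv v h y := by
  ext y
  simp only [dirDeriv]
  rw [fderiv_fun_neg]
  simp

/-- The Newtonian potential of a test function. -/
lemma newtonian_potential_smooth {m : ℕ} (hd : m < d) {φ : Ed d → ℝ}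
    (hφ : ContDiff ℝ (⊤ : ℕ∞) φ) (hc : HasCompactSupport φ) :
    ContDiff ℝ (⊤ : ℕ∞) (fun x => ∫ y, invPow d m (x - y) * φ y) := by
  have : (fun x => ∫ y, invPow d m (x - y) * φ y) =
      invPow d m ⋆[ContinuousLinearMap.mul ℝ ℝ] φ := by
    ext x
    rw [convolution_eq_swap]
    rfl
  rw [this]
  exact hc.contDiff_convolution_right _ (locallyIntegrable_invPow hd) hφ

lemma lapScalar_newtonian_potential {m : ℕ} (hd : d = m + 2) {φ : Ed d → ℝ}
    (hφ : ContDiff ℝ (⊤ : ℕ∞) φ) (hc : HasCompactSupport φ) (x : Ed d) :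
    lapScalar d (fun x => ∫ y, invPow d m (x - y) * φ y) x = -fundConst d * φ x := by
  have hl := locallyIntegrable_invPow (d := d) (m := m) (by omega)
  have e : (fun x => ∫ y, invPow d m (x - y) * φ y) =
      invPow d m ⋆[ContinuousLinearMap.mul ℝ ℝ] φ := by
    ext x
    rw [convolution_eq_swap]
    rfl
  rw [lapScalar_eq_sum (newtonian_potential_smooth (by omega) hφ hc).contDiffAt, e]
  have e2 : ∀ i : Fin d, dirDeriv (stdVec i) (dirDeriv (stdVec i)
      (invPow d m ⋆[ContinuousLinearMap.mul ℝ ℝ] φ)) x =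
      ∫ y, invPow d m y * dirDeriv (stdVec i) (dirDeriv (stdVec i) φ) (x - y) := by
    intro i
    rw [dirDeriv_convolution hl hφ hc,
      dirDeriv_convolution hl (contDiff_dirDeriv hφ _) (hasCompactSupport_dirDeriv hc _)]
    rfl
  have hφx : ContDiff ℝ (⊤ : ℕ∞) fun y => φ (x - y) := hφ.comp (by fun_prop)
  have hcx : HasCompactSupport fun y => φ (x - y) :=
    hc.comp_homeomorph (Homeomorph.subLeft x)
  have key := integral_invPow_mul_sumDeriv hd hφx hcx
  simp only [sub_zero] at key
  rw [← key, Finset.sum_congr rfl fun i _ => e2 i, ← integral_finsetSum]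
  · refine integral_congr_ae (Eventually.of_forall fun y => ?_)
    simp only [sumDeriv, Finset.mul_sum, dirDeriv_comp_const_sub hφ, dirDeriv_neg,
      dirDeriv_comp_const_sub (contDiff_dirDeriv hφ _), neg_neg]
  · intro i _
    have h2 := hasCompactSupport_dirDeriv (hasCompactSupport_dirDeriv hc (stdVec i)) (stdVec i)
    have h3 := contDiff_dirDeriv (contDiff_dirDeriv hφ (stdVec i)) (stdVec i)
    exact (h2.convolutionExists_right (ContinuousLinearMap.mul ℝ ℝ) hl h3.continuous x)

end Newtonian

section Cutoff

variable {d : ℕ} {F : Type*} [NormedAddCommGroup F] [NormedSpace ℝ F]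

lemma integrable_smul_comp_sub {g : Ed d → ℝ} (hg : Integrable g) {h : Ed d → F}
    (hh : Continuous h) {B : ℝ} (hB : ∀ z, ‖h z‖ ≤ B) (x : Ed d) :
    Integrable fun y => g y • h (x - y) :=
  hg.smul_bdd B (by fun_prop : Continuous fun y => h (x - y)).aestronglyMeasurable
    (Eventually.of_forall fun _ => hB _)

lemma continuous_integral_smul_comp_sub {g : Ed d → ℝ} (hg : Integrable g) {h : Ed d → F}
    (hh : Continuous h) {B : ℝ} (hB : ∀ z, ‖h z‖ ≤ B) :
    Continuous fun x => ∫ y, g y • h (x - y) := by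
  refine continuous_of_dominated (bound := fun y => ‖g y‖ * B)
    (fun x => (integrable_smul_comp_sub hg hh hB x).aestronglyMeasurable)
    (fun x => Eventually.of_forall fun y => ?_) (hg.norm.mul_const B)
    (Eventually.of_forall fun y => by fun_prop)
  rw [norm_smul]
  gcongr
  exact hB _

lemma hasFDerivAt_integral_smul_comp_sub {g : Ed d → ℝ} (hg : Integrable g) {h : Ed d → F}
    (hh : ContDiff ℝ 1 h) {B : ℝ} (hB : ∀ z, ‖h z‖ ≤ B) (hB' : ∀ z, ‖fderiv ℝ h z‖ ≤ B)
    (x : Ed d) :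
    HasFDerivAt (fun x => ∫ y, g y • h (x - y)) (∫ y, g y • fderiv ℝ h (x - y)) x := by
  refine hasFDerivAt_integral_of_dominated_of_fderiv_le (s := Set.univ)
    (F' := fun x y => g y • fderiv ℝ h (x - y)) (bound := fun y => ‖g y‖ * B) univ_mem
    (Eventually.of_forall fun x =>
      (integrable_smul_comp_sub hg hh.continuous hB x).aestronglyMeasurable)
    (integrable_smul_comp_sub hg hh.continuous hB x)
    (integrable_smul_comp_sub hg (hh.continuous_fderiv (by simp)) hB' x).aestronglyMeasurable
    (Eventually.of_forall fun y x _ => ?_) (hg.norm.mul_const B)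
    (Eventually.of_forall fun y x _ => ?_)
  · rw [norm_smul]
    gcongr
    exact hB' _
  · have h1 := (hh.differentiable (by simp) (x - y)).hasFDerivAt.comp x
      ((hasFDerivAt_id x).sub_const y)
    exact (h1.const_smul (g y))

/-- Convolving an integrable function with a `C²` function with bounded derivatives. -/
lemma contDiff_two_integral_mul_comp_sub {g : Ed d → ℝ} (hg : Integrable g) {h : Ed d → ℝ}
    (hh : ContDiff ℝ (⊤ : ℕ∞) h) {B : ℝ} (hB : ∀ z, ‖h z‖ ≤ B) (hB' : ∀ z, ‖fderiv ℝ h z‖ ≤ B)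
    (hB'' : ∀ z, ‖fderiv ℝ (fderiv ℝ h) z‖ ≤ B) :
    ContDiff ℝ 2 (fun x => ∫ y, g y • h (x - y)) ∧ ∀ x,
      lapScalar d (fun x => ∫ y, g y • h (x - y)) x = ∫ y, g y • lapScalar d h (x - y) := by
  have h1 : ContDiff ℝ 1 (fderiv ℝ h) := (hh.fderiv_right (m := 1) (by norm_cast))
  have D1 := hasFDerivAt_integral_smul_comp_sub hg (hh.of_le (by norm_cast)) hB hB'
  have D2 := hasFDerivAt_integral_smul_comp_sub hg h1 hB' hB''
  have c2 := h1.continuous_fderiv (by simp)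
  have e1 : fderiv ℝ (fun x => ∫ y, g y • h (x - y)) = fun x => ∫ y, g y • fderiv ℝ h (x - y) :=
    funext fun x => (D1 x).fderiv
  have e2 : fderiv ℝ (fun x => ∫ y, g y • fderiv ℝ h (x - y)) =
      fun x => ∫ y, g y • fderiv ℝ (fderiv ℝ h) (x - y) := funext fun x => (D2 x).fderiv
  constructor
  · rw [show (2 : WithTop ℕ∞) = 1 + 1 by norm_num, contDiff_succ_iff_fderiv]
    refine ⟨fun x => (D1 x).differentiableAt, by simp, ?_⟩
    rw [e1, contDiff_one_iff_fderiv]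
    refine ⟨fun x => (D2 x).differentiableAt, ?_⟩
    rw [e2]
    exact continuous_integral_smul_comp_sub hg c2 hB''
  · intro x
    have hi := integrable_smul_comp_sub hg c2 hB'' x
    have hi' : ∀ v, Integrable fun y => (g y • fderiv ℝ (fderiv ℝ h) (x - y)) v := fun v =>
      hi.apply_continuousLinearMap v
    simp only [lapScalar, iteratedFDeriv_two_apply, e1, e2]
    simp only [Finset.smul_sum]
    rw [integral_finsetSum]
    · refine Finset.sum_congr rfl fun i _ => ?_
      rw [ContinuousLinearMap.integral_apply hi, ContinuousLinearMap.integral_apply (hi' _)]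
      rfl
    · intro i _
      exact (hi' _).apply_continuousLinearMap _

lemma exists_cutoff {a : ℕ} {h : Ed d → ℝ} (hh : HomogHarmonic a h) {ε : ℝ} (hε : 0 < ε) :
    ∃ k : Ed d → ℝ, ContDiff ℝ (⊤ : ℕ∞) k ∧ (∀ z, ε < ‖z‖ → k =ᶠ[𝓝 z] h) ∧
      ∃ B, (∀ z, ‖k z‖ ≤ B) ∧ (∀ z, ‖fderiv ℝ k z‖ ≤ B) ∧
        ∀ z, ‖fderiv ℝ (fderiv ℝ k) z‖ ≤ B := by
  let η : ContDiffBump (0 : Ed d) := ⟨ε / 2, ε, by positivity, by linarith⟩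
  let k : Ed d → ℝ := fun z => (1 - η z) * h z
  have hk : ContDiff ℝ (⊤ : ℕ∞) k := by
    refine contDiff_iff_contDiffAt.2 fun z => ?_
    by_cases hz : z = 0
    · have : k =ᶠ[𝓝 z] fun _ => 0 := by
        filter_upwards [ball_mem_nhds z (half_pos hε)] with w hw
        have : η w = 1 := η.one_of_mem_closedBall (by
          rw [hz] at hw
          exact ball_subset_closedBall hw)
        simp [k, this]
      exact contDiffAt_const.congr_of_eventuallyEq this
    · exact (contDiffAt_const.sub η.contDiffAt).mul (hh.smooth z hz)
  have he : ∀ z, ε < ‖z‖ → k =ᶠ[𝓝 z] h := by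
    intro z hz
    filter_upwards [continuous_norm.continuousAt.eventually (lt_mem_nhds hz)] with w hw
    have : η w = 0 := η.zero_of_le_dist (by simpa using hw.le)
    simp [k, this]
  refine ⟨k, hk, he, ?_⟩
  have hk1 : ContDiff ℝ 1 (fderiv ℝ k) := (hk.fderiv_right (m := 1) (by norm_cast))
  have bound : ∀ {F : Type} [NormedAddCommGroup F] (q : Ed d → F), Continuous q →
      (∃ C, ∀ z, ε < ‖z‖ → ‖q z‖ ≤ C) → ∃ B, ∀ z, ‖q z‖ ≤ B := by
    intro F _ q hq ⟨C, hC⟩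
    obtain ⟨C', hC'⟩ := (isCompact_closedBall (0 : Ed d) ε).exists_bound_of_continuousOn
      hq.continuousOn
    refine ⟨max C C', fun z => ?_⟩
    by_cases hz : ε < ‖z‖
    · exact (hC z hz).trans (le_max_left _ _)
    · exact (hC' z (by simpa using hz)).trans (le_max_right _ _)
  have hne : ∀ z : Ed d, ε < ‖z‖ → z ≠ 0 := fun z hz => norm_pos_iff.1 (hε.trans hz)
  have hmono : ∀ {C : ℝ} (n : ℕ) (z : Ed d), 0 ≤ C → ε < ‖z‖ → C * (‖z‖ ^ n)⁻¹ ≤ C * (ε ^ n)⁻¹ := by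
    intro C n z hC hz
    gcongr
  obtain ⟨C0, hC0, h0⟩ := hh.exists_bound
  obtain ⟨C1, hC1, h1⟩ := hh.exists_fderiv_bound
  choose C2 hC2 h2 using fun i : Fin d => (hh.dirDeriv (stdVec i)).exists_fderiv_bound
  obtain ⟨B0, hB0⟩ := bound k hk.continuous ⟨_, fun z hz => by
    rw [(he z hz).eq_of_nhds]
    exact (h0 z (hne z hz)).trans (hmono _ z hC0 hz)⟩
  obtain ⟨B1, hB1⟩ := bound (fderiv ℝ k) (hk1.continuous) ⟨_, fun z hz => by
    rw [(he z hz).fderiv_eq]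
    exact (h1 z (hne z hz)).trans (hmono _ z hC1 hz)⟩
  obtain ⟨B2, hB2⟩ := bound (fderiv ℝ (fderiv ℝ k)) (hk1.continuous_fderiv (by simp))
    ⟨∑ i, C2 i * (ε ^ (a + 1 + 1))⁻¹, fun z hz => by
      rw [((he z hz).fderiv (𝕜 := ℝ)).fderiv_eq]
      refine (norm_le_sum_norm_stdVec _).trans (Finset.sum_le_sum fun i _ => ?_)
      rw [fderiv_fderiv_apply (hh.smooth z (hne z hz))]
      exact (h2 i z (hne z hz)).trans (hmono _ z (hC2 i) hz)⟩
  exact ⟨max B0 (max B1 B2), fun z => (hB0 z).trans (le_max_left _ _),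
    fun z => (hB1 z).trans ((le_max_left _ _).trans (le_max_right _ _)),
    fun z => (hB2 z).trans ((le_max_right _ _).trans (le_max_right _ _))⟩

/-- Away from the support of its density, a potential is `C²` and harmonic. -/
lemma potential_harmonic_off_support {a : ℕ} {h : Ed d → ℝ} (hh : HomogHarmonic a h)
    {g : Ed d → ℝ} (hg : Integrable g) {x₀ : Ed d} {ε : ℝ} (hε : 0 < ε)
    (hg0 : ∀ y ∈ ball x₀ (3 * ε), g y = 0) :
    (∀ᶠ x in 𝓝 x₀, Integrable fun y => h (x - y) * g y) ∧
      ContDiffAt ℝ 2 (fun x => ∫ y, h (x - y) * g y) x₀ ∧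
      lapScalar d (fun x => ∫ y, h (x - y) * g y) x₀ = 0 := by
  obtain ⟨k, hk, he, B, hB, hB', hB''⟩ := exists_cutoff hh hε
  have key : ∀ x ∈ ball x₀ ε, ∀ y, g y ≠ 0 → ε < ‖x - y‖ := by
    intro x hx y hy
    have h1 : ¬ dist y x₀ < 3 * ε := fun h => hy (hg0 y h)
    have h2 := dist_triangle y x x₀
    rw [← dist_eq_norm, dist_comm]
    rw [mem_ball] at hx
    linarith
  have e0 : ∀ x ∈ ball x₀ ε, (fun y => h (x - y) * g y) = fun y => g y • k (x - y) := by
    intro x hx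
    ext y
    by_cases hy : g y = 0
    · simp [hy]
    · rw [smul_eq_mul, (he _ (key x hx y hy)).eq_of_nhds, mul_comm]
  have e : (fun x => ∫ y, h (x - y) * g y) =ᶠ[𝓝 x₀] fun x => ∫ y, g y • k (x - y) := by
    filter_upwards [ball_mem_nhds x₀ hε] with x hx
    rw [e0 x hx]
  obtain ⟨c, l⟩ := contDiff_two_integral_mul_comp_sub hg hk hB hB' hB''
  refine ⟨?_, c.contDiffAt.congr_of_eventuallyEq e, ?_⟩
  · filter_upwards [ball_mem_nhds x₀ hε] with x hx
    rw [e0 x hx]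
    exact integrable_smul_comp_sub hg hk.continuous hB x
  rw [lapScalar_congr e, l]
  refine integral_eq_zero_of_ae (Eventually.of_forall fun y => ?_)
  by_cases hy : g y = 0
  · simp [hy]
  · have h1 := key x₀ (mem_ball_self hε) y hy
    simp only [Pi.zero_apply]
    rw [lapScalar_congr (he _ h1), hh.harmonic _ (norm_pos_iff.1 (hε.trans h1)), smul_zero]

end Cutoff

section Solution

open scoped Convolution

variable {d : ℕ}

lemma ContDiffAt.lapScalar_add {f g : Ed d → ℝ} {x : Ed d} (hf : ContDiffAt ℝ 2 f x)
    (hg : ContDiffAt ℝ 2 g x) :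
    lapScalar d (fun y => f y + g y) x = lapScalar d f x + lapScalar d g x := by
  simp only [lapScalar_eq_laplacian]
  exact hf.laplacian_add hg

lemma ContDiffAt.lapScalar_const_mul (c : ℝ) {f : Ed d → ℝ} {x : Ed d} (hf : ContDiffAt ℝ 2 f x) :
    lapScalar d (fun y => c * f y) x = c * lapScalar d f x := by
  simp only [lapScalar_eq_laplacian]
  exact InnerProductSpace.laplacian_smul c hf

/-- Linear combinations of `C²` functions with vanishing Laplacian. -/
lemma lapScalar_sum_const_mul_eq_zero {ι : Type*} (s : Finset ι) (c : ι → ℝ) {F : ι → Ed d → ℝ}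
    {x : Ed d} (hF : ∀ i ∈ s, ContDiffAt ℝ 2 (F i) x) (hl : ∀ i ∈ s, lapScalar d (F i) x = 0) :
    ContDiffAt ℝ 2 (fun y => ∑ i ∈ s, c i * F i y) x ∧
      lapScalar d (fun y => ∑ i ∈ s, c i * F i y) x = 0 := by
  classical
  induction s using Finset.induction_on with
  | empty => simp [lapScalar_eq_laplacian, InnerProductSpace.laplacian_const, contDiffAt_const]
  | insert i s hi ih =>
    obtain ⟨h1, h2⟩ := ih (fun j hj => hF j (Finset.mem_insert_of_mem hj))
      fun j hj => hl j (Finset.mem_insert_of_mem hj)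
    have h3 := hF i (Finset.mem_insert_self i s)
    have h4 : ContDiffAt ℝ 2 (fun y => c i * F i y) x := contDiffAt_const.mul h3
    simp only [Finset.sum_insert hi]
    refine ⟨h4.add h1, ?_⟩
    rw [h4.lapScalar_add h1, h2, h3.lapScalar_const_mul, hl i (Finset.mem_insert_self i s),
      mul_zero, zero_add]

/-- The Newtonian potential of an integrable density solves Poisson's equation wherever the density
is smooth. -/
lemma potential_poisson {m : ℕ} (hd : d = m + 2) {f : Ed d → ℝ} (hf : Integrable f) {s : Set (Ed d)}
    (hs : IsOpen s) (hfs : ContDiffOn ℝ (⊤ : ℕ∞) f s) {x₀ : Ed d} (hx₀ : x₀ ∈ s) :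
    (∀ᶠ x in 𝓝 x₀, Integrable fun y => invPow d m (x - y) * f y) ∧
      ContDiffAt ℝ 2 (fun x => ∫ y, invPow d m (x - y) * f y) x₀ ∧
      lapScalar d (fun x => ∫ y, invPow d m (x - y) * f y) x₀ = -fundConst d * f x₀ := by
  obtain ⟨δ, hδ, hδs⟩ := Metric.isOpen_iff.1 hs x₀ hx₀
  let χ : ContDiffBump x₀ := ⟨δ / 4, δ / 2, by positivity, by linarith⟩
  let φ : Ed d → ℝ := fun y => χ y * f y
  have hsupp : tsupport χ ⊆ s := by
    rw [χ.tsupport_eq]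
    exact (closedBall_subset_ball (by simp [χ]; linarith)).trans hδs
  have hφ : ContDiff ℝ (⊤ : ℕ∞) φ := by
    refine contDiff_iff_contDiffAt.2 fun z => ?_
    by_cases hz : z ∈ s
    · exact χ.contDiffAt.mul (hfs.contDiffAt (hs.mem_nhds hz))
    · have h1 : z ∉ tsupport χ := fun h => hz (hsupp h)
      have : φ =ᶠ[𝓝 z] fun _ => 0 := by
        filter_upwards [notMem_tsupport_iff_eventuallyEq.1 h1] with w hw
        simp [φ, hw]
      exact contDiffAt_const.congr_of_eventuallyEq this
  have hc : HasCompactSupport φ := χ.hasCompactSupport.mul_right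
  have hg : Integrable (fun y => f y - φ y) := hf.sub (hφ.continuous.integrable_of_hasCompactSupport hc)
  have hχ : ∀ y ∈ ball x₀ (δ / 4), χ y = 1 := fun y hy =>
    χ.one_of_mem_closedBall (ball_subset_closedBall hy)
  obtain ⟨i1, c1, l1⟩ := potential_harmonic_off_support (homogHarmonic_invPow hd) hg
    (x₀ := x₀) (ε := δ / 12) (by positivity) (fun y hy => by
      rw [show 3 * (δ / 12) = δ / 4 by ring] at hy
      simp [φ, hχ y hy])
  have hl := locallyIntegrable_invPow (d := d) (m := m) (by omega)
  have i2 : ∀ x, Integrable fun y => invPow d m (x - y) * φ y := fun x => by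
    have := (hc.convolutionExists_right (ContinuousLinearMap.mul ℝ ℝ) hl hφ.continuous x).integrable_swap
    exact this
  have c2 : ContDiffAt ℝ 2 (fun x => ∫ y, invPow d m (x - y) * φ y) x₀ :=
    (newtonian_potential_smooth (m := m) (by omega) hφ hc).contDiffAt.of_le
      (WithTop.coe_le_coe.2 (le_top : (2 : ℕ∞) ≤ ⊤))
  have l2 := lapScalar_newtonian_potential hd hφ hc x₀
  have e0 : ∀ x y, invPow d m (x - y) * f y =
      invPow d m (x - y) * (f y - φ y) + invPow d m (x - y) * φ y := fun x y => by ring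
  have e : (fun x => ∫ y, invPow d m (x - y) * f y) =ᶠ[𝓝 x₀] fun x =>
      (∫ y, invPow d m (x - y) * (f y - φ y)) + ∫ y, invPow d m (x - y) * φ y := by
    filter_upwards [i1] with x hx
    simp only [e0 x]
    exact integral_add hx (i2 x)
  refine ⟨?_, (c1.add c2).congr_of_eventuallyEq e, ?_⟩
  · filter_upwards [i1] with x hx
    simp only [e0 x]
    exact hx.add (i2 x)
  · rw [lapScalar_congr e, c1.lapScalar_add c2, l1, l2]
    simp [φ, hχ x₀ (mem_ball_self (by positivity))]

open scoped Nat in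
/-- The remainder of the Taylor expansion of `h` at `x` of order `N`, in the direction `y`. -/
def taylorRem (h : Ed d → ℝ) (N : ℕ) (x y : Ed d) : ℝ :=
  h (x + y) - ∑ j ∈ Finset.range (N + 1), (j ! : ℝ)⁻¹ * (dirDeriv y)^[j] h x

/-- The moments of a density against derivatives of a homogeneous harmonic function. -/
lemma moment_harmonic {a : ℕ} {h : Ed d → ℝ} (hh : HomogHarmonic a h) (j : ℕ)
    {f : Ed d → ℝ} (hf : AEStronglyMeasurable f volume)
    (hfj : Integrable fun y => ‖y‖ ^ j * f y) {x₀ : Ed d} (hx₀ : x₀ ≠ 0) :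
    (∀ x, x ≠ 0 → Integrable fun y => (dirDeriv (-y))^[j] h x * f y) ∧
      ContDiffAt ℝ 2 (fun x => ∫ y, (dirDeriv (-y))^[j] h x * f y) x₀ ∧
      lapScalar d (fun x => ∫ y, (dirDeriv (-y))^[j] h x * f y) x₀ = 0 := by
  obtain ⟨ι, _, p, q, hp, hpb, hq, he⟩ := hh.exists_expansion j
  have hi : ∀ i, Integrable fun y => p i (-y) * f y := fun i => by
    refine hfj.mono (((hp i).comp continuous_neg).aestronglyMeasurable.mul hf)
      (Eventually.of_forall fun y => ?_)
    rw [norm_mul, norm_mul, norm_pow, norm_norm]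
    gcongr
    simpa using hpb i (-y)
  have e0 : ∀ x, x ≠ 0 → (fun y => (dirDeriv (-y))^[j] h x * f y) =
      fun y => ∑ i, q i x * (p i (-y) * f y) := by
    intro x hx
    ext y
    rw [he x hx, Finset.sum_mul]
    exact Finset.sum_congr rfl fun i _ => by ring
  have e : (fun x => ∫ y, (dirDeriv (-y))^[j] h x * f y) =ᶠ[𝓝 x₀]
      fun x => ∑ i, (∫ y, p i (-y) * f y) * q i x := by
    filter_upwards [eventually_ne_nhds hx₀] with x hx
    rw [e0 x hx, integral_finsetSum _ fun i _ => (hi i).const_mul _]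
    exact Finset.sum_congr rfl fun i _ => by rw [integral_const_mul, mul_comm]
  obtain ⟨c, l⟩ := lapScalar_sum_const_mul_eq_zero (x := x₀) Finset.univ
    (fun i => ∫ y, p i (-y) * f y) (F := q)
    (fun i _ => ((hq i).smooth x₀ hx₀).of_le (WithTop.coe_le_coe.2 (le_top : (2 : ℕ∞) ≤ ⊤)))
    (fun i _ => (hq i).harmonic x₀ hx₀)
  refine ⟨fun x hx => ?_, c.congr_of_eventuallyEq e, by rw [lapScalar_congr e, l]⟩
  rw [e0 x hx]
  exact integrable_finsetSum _ fun i _ => (hi i).const_mul _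

open scoped Nat in
lemma lapScalar_integral_taylorRem {m : ℕ} (hd : d = m + 2) {f : Ed d → ℝ} {N : ℕ}
    (hfj : ∀ j ≤ N, Integrable fun y => ‖y‖ ^ j * f y) {s : Set (Ed d)}
    (hs : IsOpen s) (hfs : ContDiffOn ℝ (⊤ : ℕ∞) f s) {x₀ : Ed d} (hx₀ : x₀ ∈ s) (hx₀' : x₀ ≠ 0) :
    ContDiffAt ℝ 2 (fun x => ∫ y, taylorRem (invPow d m) N x (-y) * f y) x₀ ∧
    lapScalar d (fun x => ∫ y, taylorRem (invPow d m) N x (-y) * f y) x₀ = -fundConst d * f x₀ := by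
  have hf : Integrable f := by simpa using hfj 0 (Nat.zero_le _)
  obtain ⟨i1, c1, l1⟩ := potential_poisson hd hf hs hfs hx₀
  choose! i2 c2 l2 using fun j (hj : j ≤ N) => moment_harmonic (homogHarmonic_invPow hd) j
    hf.aestronglyMeasurable (hfj j hj) hx₀'
  obtain ⟨c3, l3⟩ := lapScalar_sum_const_mul_eq_zero (x := x₀) (Finset.range (N + 1))
    (fun j => -(j ! : ℝ)⁻¹) (F := fun j x => ∫ y, (dirDeriv (-y))^[j] (invPow d m) x * f y)
    (fun j hj => c2 j (by simpa [Nat.lt_succ_iff] using hj))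
    (fun j hj => l2 j (by simpa [Nat.lt_succ_iff] using hj))
  have i3 : ∀ x : Ed d, x ≠ 0 → ∀ j ∈ Finset.range (N + 1), Integrable fun y =>
      -(j ! : ℝ)⁻¹ * ((dirDeriv (-y))^[j] (invPow d m) x * f y) := fun x hx j hj =>
    (i2 j (by simpa [Nat.lt_succ_iff] using hj) x hx).const_mul _
  have e : (fun x => ∫ y, taylorRem (invPow d m) N x (-y) * f y) =ᶠ[𝓝 x₀] fun x =>
      (∫ y, invPow d m (x - y) * f y) + ∑ j ∈ Finset.range (N + 1),
        -(j ! : ℝ)⁻¹ * ∫ y, (dirDeriv (-y))^[j] (invPow d m) x * f y := by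
    filter_upwards [i1, eventually_ne_nhds hx₀'] with x hx hx0
    simp only [← integral_const_mul]
    rw [← integral_finsetSum _ (i3 x hx0), ← integral_add hx (integrable_finsetSum _ (i3 x hx0))]
    refine integral_congr_ae (Eventually.of_forall fun y => ?_)
    simp only [taylorRem, ← sub_eq_add_neg, sub_mul, Finset.sum_mul, neg_mul,
      Finset.sum_neg_distrib, mul_assoc]
  exact ⟨(c1.add c3).congr_of_eventuallyEq e, by
    rw [lapScalar_congr e, c1.lapScalar_add c3, l1, l3, add_zero]⟩

end Solution

section Weights

variable {d : ℕ}

/-- A weight with different power behaviour near zero and near infinity. -/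
def splitWeight (σ : ℝ) (N : ℕ) (w : Ed d) : ℝ :=
  (if ‖w‖ ≤ 1 / 4 then ‖w‖ ^ (N + 1) else ‖w‖ ^ N) * ‖w‖ ^ (-σ)

/-- The truncation of `invPow` to the unit ball. -/
def truncPow (k : ℕ) (z : Ed d) : ℝ := (ball 0 1).indicator (invPow d k) z

lemma splitWeight_nonneg (σ : ℝ) (N : ℕ) (w : Ed d) : 0 ≤ splitWeight σ N w := by
  unfold splitWeight; positivity

lemma truncPow_nonneg (k : ℕ) (z : Ed d) : 0 ≤ truncPow k z :=
  Set.indicator_nonneg (fun z _ => by unfold invPow; positivity) z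

lemma measurable_splitWeight (σ : ℝ) (N : ℕ) : Measurable (splitWeight (d := d) σ N) := by
  unfold splitWeight
  refine Measurable.mul (Measurable.ite (measurableSet_le measurable_norm measurable_const) ?_ ?_) ?_
  all_goals fun_prop

lemma integrable_splitWeight (hd : 1 ≤ d) {σ : ℝ} {N : ℕ} (h1 : d + N < σ) (h2 : σ < d + N + 1) :
    Integrable (splitWeight (d := d) σ N) := by
  have hm := (measurable_splitWeight (d := d) σ N).aestronglyMeasurable (μ := volume)
  have hnz : ∀ᵐ x : Ed d, x ≠ 0 := by
    have : Nontrivial (Ed d) := by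
      have : Nonempty (Fin d) := ⟨⟨0, by omega⟩⟩
      infer_instance
    exact Measure.ae_ne volume 0
  rw [← integrableOn_univ, ← Set.union_compl_self (ball (0 : Ed d) 1)]
  refine IntegrableOn.union ?_ ?_
  · refine integrableOn_ball_of_norm_le_rpow (C := 4) (α := σ - (N + 1)) (by simpa using hd)
      (by simp; linarith) (ae_restrict_of_ae_restrict_of_subset (Set.subset_univ _) ?_) hm
    rw [Measure.restrict_univ]
    filter_upwards [hnz] with x hx
    have hx' : 0 < ‖x‖ := norm_pos_iff.2 hx
    rw [Real.norm_of_nonneg (splitWeight_nonneg _ _ _), splitWeight,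
      show -(σ - (N + 1)) = ((N + 1 : ℕ) : ℝ) + -σ by push_cast; ring, Real.rpow_add hx',
      Real.rpow_natCast, ← mul_assoc]
    gcongr
    split_ifs with h
    · have : 0 ≤ ‖x‖ ^ (N + 1) := by positivity
      linarith
    · rw [pow_succ]
      have : 0 ≤ ‖x‖ ^ N := by positivity
      nlinarith
  · have hi : Integrable fun x : Ed d => 2 ^ (σ - N) * (1 + ‖x‖) ^ (-(σ - N)) :=
      (integrable_one_add_norm (by simp; linarith)).const_mul _
    refine hi.integrableOn.mono' hm.restrict ?_
    refine (ae_restrict_mem measurableSet_ball.compl).mono fun x hx => ?_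
    have hx' : 1 ≤ ‖x‖ := by simpa using hx
    have hx0 : 0 < ‖x‖ := by linarith
    rw [Real.norm_of_nonneg (splitWeight_nonneg _ _ _), splitWeight, if_neg (by linarith),
      ← Real.rpow_natCast, ← Real.rpow_add hx0, Real.rpow_neg (by positivity),
      ← Real.inv_rpow (by positivity), ← Real.mul_rpow (by positivity) (by positivity),
      show (N : ℝ) + -σ = -(σ - N) by ring, Real.rpow_neg (by positivity),
      ← Real.inv_rpow (by positivity)]
    refine Real.rpow_le_rpow (by positivity) ?_ (by linarith)
    rw [← div_eq_mul_inv, inv_eq_one_div, div_le_div_iff₀ (by positivity) (by positivity)]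
    linarith

lemma integrable_truncPow {k : ℕ} (hk : k < d) : Integrable (truncPow (d := d) k) := by
  have h := (locallyIntegrable_invPow hk).integrableOn_isCompact (isCompact_closedBall (0 : Ed d) 1)
  exact (integrable_indicator_iff measurableSet_ball).2 (h.mono_set ball_subset_closedBall)

lemma pow_le_four_pow_mul {t : ℝ} (ht : 1 / 4 < t) {j N : ℕ} (hj : j ≤ N) :
    t ^ j ≤ 4 ^ N * t ^ N := by
  rw [← mul_pow]
  calc t ^ j ≤ (4 * t) ^ j := by gcongr; linarith
    _ ≤ (4 * t) ^ N := by gcongr; linarith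

lemma invPow_mul_rpow_le {σ : ℝ} (hσ : 0 ≤ σ) (N k : ℕ) {w z : Ed d} (hw : 1 / 4 < ‖w‖) :
    invPow d k z * ‖w‖ ^ (-σ) ≤ 4 ^ σ * truncPow k z + 4 ^ N * splitWeight σ N w := by
  have hw0 : 0 < ‖w‖ := by linarith
  by_cases hz : ‖z‖ < 1
  · have h1 : ‖w‖ ^ (-σ) ≤ 4 ^ σ := by
      rw [Real.rpow_neg hw0.le, ← Real.inv_rpow hw0.le]
      refine Real.rpow_le_rpow (by positivity) ?_ hσ
      rw [inv_le_comm₀ hw0 (by norm_num)]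
      linarith
    have h2 : truncPow k z = invPow d k z := Set.indicator_of_mem (by simpa using hz) _
    rw [h2, mul_comm]
    have h3 : 0 ≤ 4 ^ N * splitWeight σ N w := mul_nonneg (by positivity) (splitWeight_nonneg _ _ _)
    have h4 : 0 ≤ invPow d k z := by unfold invPow; positivity
    nlinarith [mul_le_mul_of_nonneg_right h1 h4]
  · have h1 : invPow d k z ≤ 1 := inv_le_one_of_one_le₀ (one_le_pow₀ (not_lt.1 hz))
    have h2 : 0 ≤ 4 ^ σ * truncPow k z := mul_nonneg (by positivity) (truncPow_nonneg _ _)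
    have h3 := pow_le_four_pow_mul hw (Nat.zero_le N)
    rw [splitWeight, if_neg (by linarith), ← mul_assoc]
    have h4 : 0 ≤ ‖w‖ ^ (-σ) := by positivity
    rw [pow_zero] at h3
    nlinarith [mul_le_mul_of_nonneg_right (h1.trans h3) h4]

lemma invPow_smul (k : ℕ) {r : ℝ} (hr : 0 < r) (x : Ed d) :
    invPow d k x = (r ^ k)⁻¹ * invPow d k (r⁻¹ • x) := by
  simp only [invPow, norm_smul, norm_inv, Real.norm_of_nonneg hr.le]
  rw [← mul_inv, ← mul_pow, mul_inv_cancel_left₀ hr.ne']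

lemma abs_invPow_sub_le {m : ℕ} (hm : 1 ≤ m) {a b : Ed d} (ha : a ≠ 0) (hb : b ≠ 0) :
    |invPow d m a - invPow d m b| ≤ m * ‖a - b‖ * (invPow d (m + 1) a + invPow d (m + 1) b) := by
  have ha' : 0 < ‖a‖ := norm_pos_iff.2 ha
  have hb' : 0 < ‖b‖ := norm_pos_iff.2 hb
  simp only [invPow, ← inv_pow]
  set p := ‖a‖⁻¹ with hp
  set q := ‖b‖⁻¹ with hq
  have hp0 : 0 < p := by positivity
  have hq0 : 0 < q := by positivity
  have h1 : |p - q| ≤ ‖a - b‖ * (p * q) := by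
    have : p - q = (‖b‖ - ‖a‖) * (p * q) := by rw [hp, hq]; field_simp
    rw [this, abs_mul, abs_of_pos (by positivity : 0 < p * q)]
    gcongr
    rw [abs_sub_comm]
    exact abs_norm_sub_norm_le a b
  have h2 := abs_pow_sub_pow_le p q m
  rw [abs_of_pos hp0, abs_of_pos hq0] at h2
  have h3 : p * q ≤ (max p q) ^ 2 := by
    rw [sq]
    gcongr
    · exact le_max_left _ _
    · exact le_max_right _ _
  have h4 : (max p q) ^ (m + 1) ≤ p ^ (m + 1) + q ^ (m + 1) := by
    rcases max_choice p q with h | h <;> rw [h]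
    · linarith [pow_pos hq0 (m + 1)]
    · linarith [pow_pos hp0 (m + 1)]
  have h5 : max p q ^ (m + 1) = max p q ^ 2 * max p q ^ (m - 1) := by
    rw [← pow_add]; congr 1; omega
  have h6 : 0 ≤ max p q := hp0.le.trans (le_max_left _ _)
  calc |p ^ m - q ^ m| ≤ |p - q| * m * max p q ^ (m - 1) := h2
    _ ≤ (‖a - b‖ * max p q ^ 2) * m * max p q ^ (m - 1) := by
        gcongr
        exact h1.trans (by gcongr)
    _ = m * ‖a - b‖ * max p q ^ (m + 1) := by rw [h5]; ring
    _ ≤ _ := by gcongr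

end Weights

section KernelBounds

open scoped Nat

variable {d : ℕ}

lemma norm_pow_mul_inv_pow_add {r : ℝ} (hr : 0 < r) (y : Ed d) (p j : ℕ) :
    ‖y‖ ^ j * (r ^ (p + j))⁻¹ = (r ^ p)⁻¹ * ‖r⁻¹ • y‖ ^ j := by
  rw [norm_smul, norm_inv, Real.norm_of_nonneg hr.le, mul_pow, inv_pow, pow_add, mul_inv]
  ring

lemma sum_taylor_terms_le {r : ℝ} (hr : 0 < r) {y : Ed d} (hy : 1 / 4 < ‖r⁻¹ • y‖) {N p : ℕ}
    {A C : ℕ → ℝ} {e : ℝ} (he : 0 ≤ e) (hC : ∀ j, 0 ≤ C j)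
    (hA : ∀ j, |A j| ≤ C j * ‖y‖ ^ j * (r ^ (p + j))⁻¹ * e) :
    |∑ j ∈ Finset.range (N + 1), (j ! : ℝ)⁻¹ * A j| ≤
      (∑ j ∈ Finset.range (N + 1), C j) * 4 ^ N * ((r ^ p)⁻¹ * e * ‖r⁻¹ • y‖ ^ N) := by
  rw [Finset.sum_mul, Finset.sum_mul]
  refine (Finset.abs_sum_le_sum_abs _ _).trans (Finset.sum_le_sum fun j hj => ?_)
  rw [abs_mul, abs_of_nonneg (by positivity)]
  have h1 : (j ! : ℝ)⁻¹ ≤ 1 := inv_le_one_of_one_le₀ (by exact_mod_cast Nat.one_le_iff_ne_zero.2 (Nat.factorial_ne_zero j))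
  have h2 := pow_le_four_pow_mul hy (Nat.lt_succ_iff.1 (Finset.mem_range.1 hj))
  have hCj := hC j
  calc (j ! : ℝ)⁻¹ * |A j| ≤ 1 * (C j * ‖y‖ ^ j * (r ^ (p + j))⁻¹ * e) := by
        gcongr
        exact hA j
    _ = C j * ((r ^ p)⁻¹ * e * ‖r⁻¹ • y‖ ^ j) := by
        rw [one_mul, mul_assoc (C j), norm_pow_mul_inv_pow_add hr]; ring
    _ ≤ C j * ((r ^ p)⁻¹ * e * (4 ^ N * ‖r⁻¹ • y‖ ^ N)) := by gcongr
    _ = _ := by ring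

lemma exists_taylorRem_bound {m : ℕ} (hd : d = m + 2) {σ : ℝ} (hσ : 0 ≤ σ) (N : ℕ) :
    ∃ C : ℝ, 0 ≤ C ∧ ∀ x : Ed d, x ≠ 0 → ∀ y,
      |taylorRem (invPow d m) N x (-y)| * ‖‖x‖⁻¹ • y‖ ^ (-σ) ≤
        C * (‖x‖ ^ m)⁻¹ *
          (splitWeight σ N (‖x‖⁻¹ • y) + truncPow m (‖x‖⁻¹ • (x - y))) := by
  have hG := homogHarmonic_invPow hd
  obtain ⟨C₁, hC₁, h1⟩ := hG.exists_taylor_bound N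
  choose C hC h2 using hG.exists_iterate_bound
  set S := ∑ j ∈ Finset.range (N + 1), C j with hS
  have hS0 : 0 ≤ S := Finset.sum_nonneg fun j _ => hC j
  refine ⟨C₁ + S * 4 ^ N + 4 ^ N + 4 ^ σ, by positivity, fun x hx y => ?_⟩
  have hr : 0 < ‖x‖ := norm_pos_iff.2 hx
  have hw := splitWeight_nonneg σ N (‖x‖⁻¹ • y)
  have ht := truncPow_nonneg m (‖x‖⁻¹ • (x - y))
  have hrm : 0 ≤ (‖x‖ ^ m)⁻¹ := by positivity
  set w := ‖x‖⁻¹ • y with hwdef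
  set T := truncPow m (‖x‖⁻¹ • (x - y)) with hT
  have hyw : ‖y‖ = ‖x‖ * ‖w‖ := by
    rw [hwdef, norm_smul, norm_inv, norm_norm, mul_inv_cancel_left₀ hr.ne']
  have hpos : 0 ≤ ‖w‖ ^ (-σ) := by positivity
  have h4 : (0 : ℝ) ≤ 4 ^ σ := by positivity
  have h4N : (0 : ℝ) ≤ 4 ^ N := by positivity
  by_cases hle : ‖w‖ ≤ 1 / 4
  · have h3 := h1 x hx (-y) (by rw [norm_neg, hyw]; nlinarith)
    rw [norm_neg, mul_assoc, add_assoc m N 1, norm_pow_mul_inv_pow_add hr y m (N + 1), ← hwdef] at h3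
    have hsw : splitWeight σ N w = ‖w‖ ^ (N + 1) * ‖w‖ ^ (-σ) := by rw [splitWeight, if_pos hle]
    calc |taylorRem (invPow d m) N x (-y)| * ‖w‖ ^ (-σ)
        ≤ C₁ * ((‖x‖ ^ m)⁻¹ * ‖w‖ ^ (N + 1)) * ‖w‖ ^ (-σ) := by gcongr; exact h3
      _ = C₁ * (‖x‖ ^ m)⁻¹ * (splitWeight σ N w + 0) := by rw [hsw]; ring
      _ ≤ _ := by
        gcongr
        have : 0 ≤ S * 4 ^ N := by positivity
        linarith
  · rw [not_le] at hle
    have h3 := sum_taylor_terms_le hr hle (N := N) (p := m) (e := 1)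
      (A := fun j => (dirDeriv (-y))^[j] (invPow d m) x) zero_le_one hC
      (fun j => by simpa using h2 j x hx (-y))
    have hsw : splitWeight σ N w = ‖w‖ ^ N * ‖w‖ ^ (-σ) := by
      rw [splitWeight, if_neg (by linarith)]
    have h5 := invPow_mul_rpow_le hσ N m (z := ‖x‖⁻¹ • (x - y)) hle
    have h6 : |taylorRem (invPow d m) N x (-y)| ≤ (‖x‖ ^ m)⁻¹ * invPow d m (‖x‖⁻¹ • (x - y)) +
        S * 4 ^ N * ((‖x‖ ^ m)⁻¹ * 1 * ‖w‖ ^ N) := by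
      refine (abs_sub _ _).trans (add_le_add (le_of_eq ?_) h3)
      rw [← sub_eq_add_neg, ← invPow_smul m hr, abs_of_nonneg]
      unfold invPow; positivity
    calc |taylorRem (invPow d m) N x (-y)| * ‖w‖ ^ (-σ)
        ≤ ((‖x‖ ^ m)⁻¹ * invPow d m (‖x‖⁻¹ • (x - y)) +
          S * 4 ^ N * ((‖x‖ ^ m)⁻¹ * 1 * ‖w‖ ^ N)) * ‖w‖ ^ (-σ) := by gcongr
      _ = (‖x‖ ^ m)⁻¹ * (invPow d m (‖x‖⁻¹ • (x - y)) * ‖w‖ ^ (-σ) +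
          S * 4 ^ N * splitWeight σ N w) := by rw [hsw]; ring
      _ ≤ (‖x‖ ^ m)⁻¹ * ((4 ^ σ * T + 4 ^ N * splitWeight σ N w) +
          S * 4 ^ N * splitWeight σ N w) := by gcongr
      _ ≤ (‖x‖ ^ m)⁻¹ * ((C₁ + S * 4 ^ N + 4 ^ N + 4 ^ σ) * (splitWeight σ N w + T)) := by
        gcongr
        have : 0 ≤ (C₁ + S * 4 ^ N + 4 ^ N) * T + (C₁ + 4 ^ σ) * splitWeight σ N w := by positivity
        linarith
      _ = _ := by ring

lemma exists_taylorRem_lipschitz {m : ℕ} (hd : d = m + 2) (hm : 1 ≤ m) {σ : ℝ} (hσ : 0 ≤ σ)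
    (N : ℕ) :
    ∃ C : ℝ, 0 ≤ C ∧ ∀ x₀ : Ed d, x₀ ≠ 0 → ∀ x ∈ ball x₀ (‖x₀‖ / 8), ∀ y, y ≠ x → y ≠ x₀ →
      |taylorRem (invPow d m) N x (-y) - taylorRem (invPow d m) N x₀ (-y)| *
          ‖‖x₀‖⁻¹ • y‖ ^ (-σ) ≤
        C * (‖x₀‖ ^ (m + 1))⁻¹ * ‖x - x₀‖ *
          (splitWeight σ N (‖x₀‖⁻¹ • y) + (truncPow (m + 1) (‖x₀‖⁻¹ • (x - y)) +
            truncPow (m + 1) (‖x₀‖⁻¹ • (x₀ - y)))) := by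
  have hG := homogHarmonic_invPow hd
  obtain ⟨C₁, hC₁, h1⟩ := hG.exists_taylor_lipschitz N
  choose C hC h2 using hG.exists_iterate_lipschitz
  set S := ∑ j ∈ Finset.range (N + 1), C j with hS
  have hS0 : 0 ≤ S := Finset.sum_nonneg fun j _ => hC j
  refine ⟨C₁ + S * 4 ^ N + 2 * m * 4 ^ N + m * 4 ^ σ, by positivity,
    fun x₀ hx₀ x hx y hyx hyx₀ => ?_⟩
  have hr : 0 < ‖x₀‖ := norm_pos_iff.2 hx₀
  have hx₀b : x₀ ∈ ball x₀ (‖x₀‖ / 8) := mem_ball_self (by positivity)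
  have hw := splitWeight_nonneg σ N (‖x₀‖⁻¹ • y)
  have ht := truncPow_nonneg (m + 1) (‖x₀‖⁻¹ • (x - y))
  have ht' := truncPow_nonneg (m + 1) (‖x₀‖⁻¹ • (x₀ - y))
  have hrm : 0 ≤ (‖x₀‖ ^ (m + 1))⁻¹ := by positivity
  set w := ‖x₀‖⁻¹ • y with hwdef
  set T := truncPow (m + 1) (‖x₀‖⁻¹ • (x - y)) with hT
  set T' := truncPow (m + 1) (‖x₀‖⁻¹ • (x₀ - y)) with hT'
  set R := (‖x₀‖ ^ (m + 1))⁻¹ with hR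
  set e := ‖x - x₀‖ with he
  have he0 : 0 ≤ e := norm_nonneg _
  have hyw : ‖y‖ = ‖x₀‖ * ‖w‖ := by
    rw [hwdef, norm_smul, norm_inv, norm_norm, mul_inv_cancel_left₀ hr.ne']
  have hpos : 0 ≤ ‖w‖ ^ (-σ) := by positivity
  have h4 : (0 : ℝ) ≤ 4 ^ σ := by positivity
  have h4N : (0 : ℝ) ≤ 4 ^ N := by positivity
  by_cases hle : ‖w‖ ≤ 1 / 4
  · have h3 := h1 x₀ hx₀ x hx x₀ hx₀b (-y) (by rw [norm_neg, hyw]; nlinarith)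
    rw [norm_neg, mul_assoc C₁, show m + N + 2 = (m + 1) + (N + 1) by ring,
      norm_pow_mul_inv_pow_add hr y (m + 1) (N + 1), ← hwdef] at h3
    have hsw : splitWeight σ N w = ‖w‖ ^ (N + 1) * ‖w‖ ^ (-σ) := by rw [splitWeight, if_pos hle]
    calc |taylorRem (invPow d m) N x (-y) - taylorRem (invPow d m) N x₀ (-y)| * ‖w‖ ^ (-σ)
        ≤ C₁ * (R * ‖w‖ ^ (N + 1)) * e * ‖w‖ ^ (-σ) := by gcongr; exact h3
      _ = C₁ * R * e * (splitWeight σ N w + 0) := by rw [hsw]; ring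
      _ ≤ _ := by
        gcongr
        · have : 0 ≤ S * 4 ^ N + 2 * m * 4 ^ N + m * 4 ^ σ := by positivity
          linarith
        · positivity
  · rw [not_le] at hle
    have h3 := sum_taylor_terms_le hr hle (N := N) (p := m + 1) (e := e)
      (A := fun j => (dirDeriv (-y))^[j] (invPow d m) x - (dirDeriv (-y))^[j] (invPow d m) x₀)
      he0 hC (fun j => by
        have := h2 j x₀ hx₀ x hx x₀ hx₀b (-y)
        rwa [norm_neg, show m + j + 1 = m + 1 + j by ring] at this)
    have hsw : splitWeight σ N w = ‖w‖ ^ N * ‖w‖ ^ (-σ) := by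
      rw [splitWeight, if_neg (by linarith)]
    have h5 := invPow_mul_rpow_le hσ N (m + 1) (z := ‖x₀‖⁻¹ • (x - y)) hle
    have h5' := invPow_mul_rpow_le hσ N (m + 1) (z := ‖x₀‖⁻¹ • (x₀ - y)) hle
    have h7 := abs_invPow_sub_le (d := d) hm (sub_ne_zero.2 hyx.symm) (sub_ne_zero.2 hyx₀.symm)
    rw [sub_sub_sub_cancel_right, invPow_smul (m + 1) hr (x - y),
      invPow_smul (m + 1) hr (x₀ - y)] at h7
    set P := invPow d (m + 1) (‖x₀‖⁻¹ • (x - y)) with hP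
    set P' := invPow d (m + 1) (‖x₀‖⁻¹ • (x₀ - y)) with hP'
    have h6 : |taylorRem (invPow d m) N x (-y) - taylorRem (invPow d m) N x₀ (-y)| ≤
        m * e * (R * P + R * P') + S * 4 ^ N * (R * e * ‖w‖ ^ N) := by
      have : taylorRem (invPow d m) N x (-y) - taylorRem (invPow d m) N x₀ (-y) =
          (invPow d m (x - y) - invPow d m (x₀ - y)) - ∑ j ∈ Finset.range (N + 1),
            (j ! : ℝ)⁻¹ * ((dirDeriv (-y))^[j] (invPow d m) x -
              (dirDeriv (-y))^[j] (invPow d m) x₀) := by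
        simp only [taylorRem, ← sub_eq_add_neg, mul_sub, Finset.sum_sub_distrib]
        ring
      rw [this]
      exact (abs_sub _ _).trans (add_le_add h7 h3)
    calc |taylorRem (invPow d m) N x (-y) - taylorRem (invPow d m) N x₀ (-y)| * ‖w‖ ^ (-σ)
        ≤ (m * e * (R * P + R * P') + S * 4 ^ N * (R * e * ‖w‖ ^ N)) * ‖w‖ ^ (-σ) := by gcongr
      _ = R * e * (m * (P * ‖w‖ ^ (-σ)) + m * (P' * ‖w‖ ^ (-σ)) +
          S * 4 ^ N * splitWeight σ N w) := by rw [hsw]; ring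
      _ ≤ R * e * (m * (4 ^ σ * T + 4 ^ N * splitWeight σ N w) +
          m * (4 ^ σ * T' + 4 ^ N * splitWeight σ N w) + S * 4 ^ N * splitWeight σ N w) := by
        gcongr
      _ ≤ R * e * ((C₁ + S * 4 ^ N + 2 * m * 4 ^ N + m * 4 ^ σ) *
          (splitWeight σ N w + (T + T'))) := by
        gcongr
        have : 0 ≤ (C₁ + S * 4 ^ N + 2 * m * 4 ^ N) * (T + T') +
          (C₁ + m * 4 ^ σ) * splitWeight σ N w := by positivity
        linarith
      _ = _ := by ring

end KernelBounds

section Estimates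

variable {d : ℕ}

lemma integrable_comp_inv_smul_sub {F : Ed d → ℝ} (hF : Integrable F) {r : ℝ} (hr : 0 < r)
    (x : Ed d) : Integrable (fun y => F (r⁻¹ • (x - y))) ∧
      ∫ y, F (r⁻¹ • (x - y)) = r ^ d * ∫ y, F y := by
  have h := hF.comp_smul (inv_ne_zero hr.ne')
  refine ⟨h.comp_sub_left x, ?_⟩
  rw [integral_sub_left_eq_self (fun y => F (r⁻¹ • y)),
    Measure.integral_comp_inv_smul_of_nonneg _ _ hr.le]
  simp

lemma integrable_comp_inv_smul {F : Ed d → ℝ} (hF : Integrable F) {r : ℝ} (hr : 0 < r) :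
    Integrable (fun y => F (r⁻¹ • y)) ∧ ∫ y, F (r⁻¹ • y) = r ^ d * ∫ y, F y := by
  refine ⟨hF.comp_smul (inv_ne_zero hr.ne'), ?_⟩
  rw [Measure.integral_comp_inv_smul_of_nonneg _ _ hr.le]
  simp

lemma HomogHarmonic.continuous_iterate_dirDeriv {a : ℕ} {h : Ed d → ℝ} (hh : HomogHarmonic a h)
    (j : ℕ) {x : Ed d} (hx : x ≠ 0) : Continuous fun y => (_root_.dirDeriv y)^[j] h x := by
  obtain ⟨ι, _, p, q, hp, -, -, he⟩ := hh.exists_expansion j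
  simp only [he x hx]
  exact continuous_finsetSum _ fun i _ => (hp i).mul continuous_const

lemma measurable_taylorRem {m : ℕ} (hd : d = m + 2) (N : ℕ) {x : Ed d} (hx : x ≠ 0) :
    Measurable fun y => taylorRem (invPow d m) N x (-y) := by
  unfold taylorRem
  refine Measurable.sub ((measurable_invPow m).comp (by fun_prop)) ?_
  refine Continuous.measurable (continuous_finsetSum _ fun j _ => continuous_const.mul ?_)
  exact ((homogHarmonic_invPow hd).continuous_iterate_dirDeriv j hx).comp continuous_neg

lemma norm_rpow_neg_eq {r : ℝ} (hr : 0 < r) (σ : ℝ) (y : Ed d) :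
    ‖y‖ ^ (-σ) = r ^ (-σ) * ‖r⁻¹ • y‖ ^ (-σ) := by
  rw [norm_smul, norm_inv, Real.norm_of_nonneg hr.le, ← Real.mul_rpow hr.le (by positivity),
    mul_inv_cancel_left₀ hr.ne']

lemma exists_integral_taylorRem_bound {m : ℕ} (hd : d = m + 2) {σ : ℝ} {N : ℕ}
    (h1 : d + N < σ) (h2 : σ < d + N + 1) :
    ∃ C : ℝ, 0 ≤ C ∧ ∀ f : Ed d → ℝ, AEStronglyMeasurable f volume →
      (∀ y ≠ 0, |f y| ≤ ‖y‖ ^ (-σ)) → ∀ x ≠ 0,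
        Integrable (fun y => taylorRem (invPow d m) N x (-y) * f y) ∧
        |∫ y, taylorRem (invPow d m) N x (-y) * f y| ≤ C * ((‖x‖ ^ m)⁻¹ * ‖x‖ ^ d * ‖x‖ ^ (-σ)) := by
  have hσ : 0 ≤ σ := by
    have : (0 : ℝ) ≤ d + N := by positivity
    linarith
  obtain ⟨C, hC, hK⟩ := exists_taylorRem_bound hd hσ N
  have hiS := integrable_splitWeight (d := d) (by omega) h1 h2
  have hiT := integrable_truncPow (d := d) (k := m) (by omega)
  set I₁ := ∫ y, splitWeight (d := d) σ N y
  set I₂ := ∫ y, truncPow (d := d) m y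
  have hI₁ : 0 ≤ I₁ := integral_nonneg fun y => splitWeight_nonneg _ _ _
  have hI₂ : 0 ≤ I₂ := integral_nonneg fun y => truncPow_nonneg _ _
  refine ⟨C * (I₁ + I₂), by positivity, fun f hf hfb x hx => ?_⟩
  have hr : 0 < ‖x‖ := norm_pos_iff.2 hx
  have hnz : ∀ᵐ y : Ed d, y ≠ 0 := by
    have : Nontrivial (Ed d) := ⟨⟨x, 0, hx⟩⟩
    exact Measure.ae_ne volume 0
  obtain ⟨iS, eS⟩ := integrable_comp_inv_smul hiS hr
  obtain ⟨iT, eT⟩ := integrable_comp_inv_smul_sub hiT hr x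
  set B : Ed d → ℝ := fun y => ‖x‖ ^ (-σ) * (C * (‖x‖ ^ m)⁻¹) *
    (splitWeight σ N (‖x‖⁻¹ • y) + truncPow m (‖x‖⁻¹ • (x - y))) with hB
  have hBi : Integrable B := (iS.add iT).const_mul _
  have hle : ∀ᵐ y, ‖taylorRem (invPow d m) N x (-y) * f y‖ ≤ B y := by
    filter_upwards [hnz] with y hy
    have h3 := hfb y hy
    rw [norm_rpow_neg_eq hr] at h3
    rw [norm_mul, Real.norm_eq_abs, Real.norm_eq_abs, hB]
    calc _ ≤ |taylorRem (invPow d m) N x (-y)| * (‖x‖ ^ (-σ) * ‖‖x‖⁻¹ • y‖ ^ (-σ)) := by gcongr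
      _ = ‖x‖ ^ (-σ) * (|taylorRem (invPow d m) N x (-y)| * ‖‖x‖⁻¹ • y‖ ^ (-σ)) := by ring
      _ ≤ _ := by
        beta_reduce
        rw [mul_assoc (‖x‖ ^ (-σ))]
        exact mul_le_mul_of_nonneg_left (hK x hx y) (by positivity)
  refine ⟨hBi.mono' ((measurable_taylorRem hd N hx).aestronglyMeasurable.mul hf) hle, ?_⟩
  refine (norm_integral_le_of_norm_le hBi hle).trans (le_of_eq ?_)
  rw [hB, integral_const_mul, integral_add iS iT, eS, eT]
  ring

lemma exists_integral_taylorRem_lipschitz {m : ℕ} (hd : d = m + 2) (hm : 1 ≤ m) {σ : ℝ} {N : ℕ}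
    (h1 : d + N < σ) (h2 : σ < d + N + 1) :
    ∃ C : ℝ, 0 ≤ C ∧ ∀ f : Ed d → ℝ, AEStronglyMeasurable f volume →
      (∀ y ≠ 0, |f y| ≤ ‖y‖ ^ (-σ)) → ∀ x₀ ≠ 0, ∀ x ∈ ball x₀ (‖x₀‖ / 8),
        |(∫ y, taylorRem (invPow d m) N x (-y) * f y) -
            ∫ y, taylorRem (invPow d m) N x₀ (-y) * f y| ≤
          C * ((‖x₀‖ ^ (m + 1))⁻¹ * ‖x₀‖ ^ d * ‖x₀‖ ^ (-σ)) * ‖x - x₀‖ := by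
  have hσ : 0 ≤ σ := by
    have : (0 : ℝ) ≤ d + N := by positivity
    linarith
  obtain ⟨C, hC, hK⟩ := exists_taylorRem_lipschitz hd hm hσ N
  obtain ⟨C', -, hint⟩ := exists_integral_taylorRem_bound hd h1 h2
  have hiS := integrable_splitWeight (d := d) (by omega) h1 h2
  have hiT := integrable_truncPow (d := d) (k := m + 1) (by omega)
  set I₁ := ∫ y, splitWeight (d := d) σ N y
  set I₂ := ∫ y, truncPow (d := d) (m + 1) y
  have hI₁ : 0 ≤ I₁ := integral_nonneg fun y => splitWeight_nonneg _ _ _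
  have hI₂ : 0 ≤ I₂ := integral_nonneg fun y => truncPow_nonneg _ _
  refine ⟨C * (I₁ + (I₂ + I₂)), by positivity, fun f hf hfb x₀ hx₀ x hx => ?_⟩
  have hr : 0 < ‖x₀‖ := norm_pos_iff.2 hx₀
  have hx0 : x ≠ 0 := norm_pos_iff.1 (by linarith [HomogHarmonic.half_le_norm_of_mem_ball hx])
  have hnz : ∀ z : Ed d, ∀ᵐ y : Ed d, y ≠ z := by
    have : Nontrivial (Ed d) := ⟨⟨x, 0, hx0⟩⟩
    exact Measure.ae_ne volume
  obtain ⟨iS, eS⟩ := integrable_comp_inv_smul hiS hr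
  obtain ⟨iT, eT⟩ := integrable_comp_inv_smul_sub hiT hr x
  obtain ⟨iT', eT'⟩ := integrable_comp_inv_smul_sub hiT hr x₀
  set B : Ed d → ℝ := fun y => ‖x₀‖ ^ (-σ) * (C * (‖x₀‖ ^ (m + 1))⁻¹ * ‖x - x₀‖) *
    (splitWeight σ N (‖x₀‖⁻¹ • y) + (truncPow (m + 1) (‖x₀‖⁻¹ • (x - y)) +
      truncPow (m + 1) (‖x₀‖⁻¹ • (x₀ - y)))) with hB
  have iTT : Integrable fun y => truncPow (m + 1) (‖x₀‖⁻¹ • (x - y)) +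
      truncPow (m + 1) (‖x₀‖⁻¹ • (x₀ - y)) := iT.add iT'
  have hBi : Integrable B := (iS.add iTT).const_mul _
  rw [← integral_sub (hint f hf hfb x hx0).1 (hint f hf hfb x₀ hx₀).1]
  have hle : ∀ᵐ y, ‖taylorRem (invPow d m) N x (-y) * f y -
      taylorRem (invPow d m) N x₀ (-y) * f y‖ ≤ B y := by
    filter_upwards [hnz 0, hnz x, hnz x₀] with y hy hyx hyx₀
    have h3 := hfb y hy
    rw [norm_rpow_neg_eq hr] at h3
    rw [← sub_mul, norm_mul, Real.norm_eq_abs, Real.norm_eq_abs, hB]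
    set D := |taylorRem (invPow d m) N x (-y) - taylorRem (invPow d m) N x₀ (-y)|
    calc _ ≤ D * (‖x₀‖ ^ (-σ) * ‖‖x₀‖⁻¹ • y‖ ^ (-σ)) := by gcongr
      _ = ‖x₀‖ ^ (-σ) * (D * ‖‖x₀‖⁻¹ • y‖ ^ (-σ)) := by ring
      _ ≤ _ := by
        beta_reduce
        rw [mul_assoc (‖x₀‖ ^ (-σ))]
        exact mul_le_mul_of_nonneg_left (hK x₀ hx₀ x hx y hyx hyx₀) (by positivity)
  refine (norm_integral_le_of_norm_le hBi hle).trans (le_of_eq ?_)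
  rw [hB, integral_const_mul, integral_add iS iTT, integral_add iT iT', eS, eT, eT']
  ring

lemma integrable_norm_pow_mul {σ : ℝ} {j : ℕ} (h : d + j < σ) {f : Ed d → ℝ}
    (hf : AEStronglyMeasurable f volume) (hf0 : ∀ y, ‖y‖ ≤ 1 → f y = 0)
    (hfb : ∀ y, |f y| ≤ ‖y‖ ^ (-σ)) : Integrable fun y => ‖y‖ ^ j * f y := by
  have hi : Integrable fun x : Ed d => 2 ^ (σ - j) * (1 + ‖x‖) ^ (-(σ - j)) :=
    (integrable_one_add_norm (by simp; linarith)).const_mul _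
  refine hi.mono' ((by fun_prop : Continuous fun y : Ed d => ‖y‖ ^ j).aestronglyMeasurable.mul hf)
    (Eventually.of_forall fun x => ?_)
  by_cases hx : ‖x‖ ≤ 1
  · rw [hf0 x hx, mul_zero, norm_zero]
    positivity
  · have hx' : 1 < ‖x‖ := not_le.1 hx
    have hx0 : 0 < ‖x‖ := by linarith
    have hd0 : (0 : ℝ) ≤ d := by positivity
    rw [norm_mul, norm_pow, norm_norm]
    calc ‖x‖ ^ j * ‖f x‖ ≤ ‖x‖ ^ j * ‖x‖ ^ (-σ) := by gcongr; exact hfb x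
      _ = (‖x‖⁻¹) ^ (σ - j) := by
        rw [← Real.rpow_natCast, ← Real.rpow_add hx0, Real.inv_rpow hx0.le,
          ← Real.rpow_neg hx0.le]
        congr 1; ring
      _ ≤ (2 * (1 + ‖x‖)⁻¹) ^ (σ - j) := by
        refine Real.rpow_le_rpow (by positivity) ?_ (by linarith)
        rw [← div_eq_mul_inv, inv_eq_one_div, div_le_div_iff₀ (by positivity) (by positivity)]
        linarith
      _ = _ := by
        rw [Real.mul_rpow (by positivity) (by positivity), Real.inv_rpow (by positivity),
          ← Real.rpow_neg (by positivity)]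

end Estimates

/-- **Pointwise decay for Poisson's equation in an exterior domain (Lemma A.1).**
Let `d ≥ 3` and `γ > d−2`, `γ ∉ ℕ`. There is `C = C(d, γ) > 0` such that for every `f` on
`ℝ^d∖B₁` with `|f(x)| ≤ |x|^{−(γ+2)}` for `|x| ≥ 1`, there exists `u` with `Δu = f` in
`ℝ^d∖B₁` and `|u(x)|/r + |∇u(x)| ≤ C r^{−(γ+1)}` for `r = |x| ≥ 1`. -/
theorem poisson_pointwise_decay (d : ℕ) (hd : 3 ≤ d) (γ : ℝ)
    (hγ : (d : ℝ) - 2 < γ) (hγN : ∀ k : ℕ, γ ≠ k) :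
    ∃ C : ℝ, 0 < C ∧
      ∀ f : Ed d → ℝ, ContDiffOn ℝ (⊤ : ℕ∞) f {x : Ed d | 1 < ‖x‖} →
        (∀ x : Ed d, 1 ≤ ‖x‖ → |f x| ≤ ‖x‖ ^ (-(γ + 2))) →
        ∃ u : Ed d → ℝ,
          (∀ x : Ed d, 1 < ‖x‖ → lapScalar d u x = f x) ∧
          ∀ x : Ed d, 1 ≤ ‖x‖ →
            |u x| / ‖x‖ + ‖fderiv ℝ u x‖ ≤ C * ‖x‖ ^ (-(γ + 1)) := by
  obtain ⟨m, hdm⟩ : ∃ m, d = m + 2 := ⟨d - 2, by omega⟩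
  have hm : 1 ≤ m := by omega
  have hdm' : (d : ℝ) = m + 2 := by exact_mod_cast hdm
  set N := ⌊γ - m⌋₊ with hN
  have hγm : 0 ≤ γ - m := by linarith
  have hfl := Nat.floor_le hγm
  have hfl' := Nat.lt_floor_add_one (γ - m)
  rw [← hN] at hfl hfl'
  have hne : (N : ℝ) ≠ γ - m := fun h => hγN (m + N) (by push_cast; linarith)
  have h1 : (d : ℝ) + N < γ + 2 := by linarith [lt_of_le_of_ne hfl hne]
  have h2 : γ + 2 < d + N + 1 := by linarith
  obtain ⟨C₁, hC₁, hK₁⟩ := exists_integral_taylorRem_bound hdm h1 h2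
  obtain ⟨C₂, hC₂, hK₂⟩ := exists_integral_taylorRem_lipschitz hdm hm h1 h2
  have hc := fundConst_pos (d := d) (by omega)
  set c := fundConst d with hcd
  refine ⟨c⁻¹ * (C₁ + C₂) + 1, by positivity, fun f hf hfb => ?_⟩
  set s : Set (Ed d) := {x | 1 < ‖x‖} with hs
  have hso : IsOpen s := isOpen_lt continuous_const continuous_norm
  set g : Ed d → ℝ := s.indicator f with hg
  have hgs : ∀ y ∈ s, g y = f y := fun y hy => Set.indicator_of_mem hy f
  have hg0 : ∀ y, ‖y‖ ≤ 1 → g y = 0 := fun y hy =>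
    Set.indicator_of_notMem (by simpa [hs] using hy) f
  have hgm : AEStronglyMeasurable g volume :=
    (aestronglyMeasurable_indicator_iff hso.measurableSet).2
      (hf.continuousOn.aestronglyMeasurable hso.measurableSet)
  have hgb : ∀ y, |g y| ≤ ‖y‖ ^ (-(γ + 2)) := fun y => by
    by_cases hy : 1 < ‖y‖
    · rw [hgs y hy]
      exact hfb y hy.le
    · rw [hg0 y (not_lt.1 hy), abs_zero]
      positivity
  have hgc : ContDiffOn ℝ (⊤ : ℕ∞) g s := hf.congr hgs
  set v : Ed d → ℝ := fun x => ∫ y, taylorRem (invPow d m) N x (-y) * g y with hv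
  refine ⟨fun x => -c⁻¹ * v x, fun x hx => ?_, fun x hx => ?_⟩
  · have hx0 : x ≠ 0 := norm_pos_iff.1 (zero_lt_one.trans hx)
    obtain ⟨hv2, hvl⟩ := lapScalar_integral_taylorRem (N := N) hdm (fun j hj =>
      integrable_norm_pow_mul (σ := γ + 2) (j := j)
        (by have : (j : ℝ) ≤ N := by exact_mod_cast hj
            linarith) hgm hg0 hgb) hso hgc hx hx0
    rw [hv2.lapScalar_const_mul, hvl, hgs x hx]
    rw [← hcd]
    field_simp
  · have hr : 0 < ‖x‖ := zero_lt_one.trans_le hx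
    have hx0 : x ≠ 0 := norm_pos_iff.1 hr
    have hpow : (‖x‖ ^ (m + 1))⁻¹ * ‖x‖ ^ d * ‖x‖ ^ (-(γ + 2)) = ‖x‖ ^ (-(γ + 1)) := by
      have hd2 : ‖x‖ ^ d = ‖x‖ ^ (m + 1) * ‖x‖ := by rw [← pow_succ]; congr 1
      rw [hd2, inv_mul_cancel_left₀ (by positivity),
        ← Real.rpow_one_add' hr.le (by linarith)]
      congr 1
      ring
    have hv1 : |v x| ≤ C₁ * ‖x‖ ^ (-(γ + 1)) * ‖x‖ := by
      refine ((hK₁ g hgm (fun y _ => hgb y) x hx0).2).trans (le_of_eq ?_)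
      rw [← hpow, pow_succ ‖x‖ m]
      field_simp
    have hv2 : ‖fderiv ℝ (fun x => -c⁻¹ * v x) x‖ ≤ c⁻¹ * (C₂ * ‖x‖ ^ (-(γ + 1))) := by
      refine norm_fderiv_le_of_lip' ℝ (by positivity) ?_
      filter_upwards [ball_mem_nhds x (by positivity : 0 < ‖x‖ / 8)] with z hz
      have h3 := hK₂ g hgm (fun y _ => hgb y) x hx0 z hz
      rw [hpow] at h3
      rw [← mul_sub, norm_mul, norm_neg, Real.norm_of_nonneg (inv_nonneg.2 hc.le), mul_assoc]
      exact mul_le_mul_of_nonneg_left h3 (inv_nonneg.2 hc.le)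
    have hv3 : |-c⁻¹ * v x| / ‖x‖ ≤ c⁻¹ * (C₁ * ‖x‖ ^ (-(γ + 1))) := by
      rw [div_le_iff₀ hr, abs_mul, abs_neg, abs_of_pos (inv_pos.2 hc), mul_assoc]
      exact mul_le_mul_of_nonneg_left hv1 (inv_nonneg.2 hc.le)
    have hp : 0 < ‖x‖ ^ (-(γ + 1)) := Real.rpow_pos_of_pos hr _
    calc _ ≤ c⁻¹ * (C₁ * ‖x‖ ^ (-(γ + 1))) + c⁻¹ * (C₂ * ‖x‖ ^ (-(γ + 1))) := add_le_add hv3 hv2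
      _ ≤ (c⁻¹ * (C₁ + C₂) + 1) * ‖x‖ ^ (-(γ + 1)) := by linarith

end
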